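/- arXiv:2502.19775 — 3 statements merged into one kernel-verified Lean document; each statement's English description precedes it below -/
import Mathlib

section
/- There exists a constant C > 0 such that for every weakly differentiable f : ℝ² → ℝ with ∫_{ℝ²} (1+|y|²) f² < ∞ and ∫_{ℝ²} |∇f|²/U < ∞, one has the sub-coercivity estimate ∫_{ℝ²} U |∇(f/U − Ψ_f)|² ≥ (1/C) ∫_{ℝ²} |∇f|²/U − C ∫_{ℝ²} (1+|y|) f². -/
open MeasureTheory
open scoped RealInnerProductSpace

noncomputable section

abbrev E2 : Type := EuclideanSpace ℝ (Fin 2)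

/-- The stationary state `U(y) = 8 / (1 + |y|²)²`. -/
def U2 (y : E2) : ℝ := 8 / (1 + ‖y‖ ^ 2) ^ 2

/-- The 2D Poisson field `Ψ_g(x) = −(1/2π) ∫ log|x−y| g(y) dy`. -/
def Psi (g : E2 → ℝ) (x : E2) : ℝ :=
  -(1 / (2 * Real.pi)) * ∫ y : E2, Real.log ‖x - y‖ * g y

/-- The scaling operator `Λf(y) = 2 f(y) + y·∇f(y)`. -/
def Lam (f : E2 → ℝ) (y : E2) : ℝ := 2 * f y + ⟪y, gradient f y⟫

/-- Partial derivative in the `i`-th coordinate direction. -/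
def pd (i : Fin 2) (f : E2 → ℝ) (y : E2) : ℝ := fderiv ℝ f y (EuclideanSpace.single i 1)

/-- The rescaled stationary state `U_ν(y) = ν⁻² U(y/ν)`. -/
def Unu (ν : ℝ) (y : E2) : ℝ := (1 / ν ^ 2) * U2 ((1 / ν) • y)

lemma oneAddSq_pos (y : E2) : 0 < 1 + ‖y‖ ^ 2 := by positivity

lemma div_U2 (a : ℝ) (y : E2) : a / U2 y = a * ((1 + ‖y‖ ^ 2) ^ 2 / 8) := by
  unfold U2
  have := oneAddSq_pos y
  field_simp

lemma U2_pos (y : E2) : 0 < U2 y := by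
  unfold U2; positivity

lemma hasGradientAt_normsq (y : E2) :
    HasGradientAt (fun z : E2 => ‖z‖ ^ 2) ((2:ℝ) • y) y := by
  rw [hasGradientAt_iff_hasFDerivAt]
  refine (hasStrictFDerivAt_norm_sq y).hasFDerivAt.congr_fderiv ?_
  ext v
  simp

lemma hasGradientAt_div (f : E2 → ℝ) (hf : Differentiable ℝ f) (y : E2) :
    HasGradientAt (fun z => f z / U2 z)
      (((1 + ‖y‖ ^ 2) ^ 2 / 8) • gradient f y + (f y * (1 + ‖y‖ ^ 2) / 2) • y) y := by
  have h1 := (hf y).hasGradientAt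
  have h2 := hasGradientAt_normsq y
  rw [hasGradientAt_iff_hasFDerivAt] at *
  have h3 := h1.mul (((h2.const_add 1).pow 2).mul_const (1/8))
  have e : (fun z => f z / U2 z) = fun z => f z * ((1 + ‖z‖^2)^2 * (1/8)) := by
    funext z; rw [div_U2]; ring
  rw [e]
  refine h3.congr_fderiv ?_
  ext v
  simp
  ring

lemma normsq_grad_div (f : E2 → ℝ) (hf : Differentiable ℝ f) (y : E2) :
    U2 y * ‖gradient (fun z => f z / U2 z) y‖ ^ 2 =
      ‖gradient f y‖ ^ 2 / U2 y + f y * (1 + ‖y‖ ^ 2) * ⟪y, gradient f y⟫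
        + 2 * ‖y‖ ^ 2 * f y ^ 2 := by
  rw [(hasGradientAt_div f hf y).gradient, norm_add_sq_real, div_U2]
  simp only [norm_smul, inner_smul_left, inner_smul_right, mul_pow, Real.norm_eq_abs, sq_abs]
  rw [real_inner_comm]
  unfold U2
  have := oneAddSq_pos y
  simp
  field_simp
  ring

lemma measurable_grad (f : E2 → ℝ) : Measurable (gradient f) := by
  unfold gradient
  exact (InnerProductSpace.toDual ℝ E2).symm.continuous.measurable.comp (measurable_fderiv ℝ f)

lemma cross_bound (f : E2 → ℝ) (y : E2) :
    |f y * (1 + ‖y‖ ^ 2) * ⟪y, gradient f y⟫| ≤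
      4 * (‖gradient f y‖ ^ 2 / U2 y) + (1 + ‖y‖ ^ 2) * f y ^ 2 := by
  have h := abs_real_inner_le_norm y (gradient f y)
  rw [div_U2, abs_mul, abs_mul, abs_of_pos (oneAddSq_pos y)]
  have h2 : |f y| * (1 + ‖y‖ ^ 2) * |⟪y, gradient f y⟫| ≤
     |f y| * (1 + ‖y‖ ^ 2) * (‖y‖ * ‖gradient f y‖) := by gcongr
  refine h2.trans ?_
  have h3 : f y ^ 2 = |f y| ^ 2 := by simp
  rw [h3]
  set g := ‖gradient f y‖
  set r := ‖y‖
  set a := |f y|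
  nlinarith [sq_nonneg ((1 + r^2) * g - a * r), sq_nonneg a, sq_nonneg (a*r)]

lemma cross_integrable (f : E2 → ℝ) (hf : Differentiable ℝ f)
    (h1 : Integrable (fun y : E2 => (1 + ‖y‖ ^ 2) * (f y) ^ 2))
    (h2 : Integrable (fun y : E2 => ‖gradient f y‖ ^ 2 / U2 y)) :
    Integrable (fun y : E2 => f y * (1 + ‖y‖ ^ 2) * ⟪y, gradient f y⟫) := by
  refine ((h2.const_mul 4).add h1).mono' ?_ (.of_forall fun y => cross_bound f y)
  have := hf.continuous.measurable
  have := measurable_grad f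
  exact (by fun_prop : Measurable _).aestronglyMeasurable

lemma sq_integrable (f : E2 → ℝ) (hf : Differentiable ℝ f)
    (h1 : Integrable (fun y : E2 => (1 + ‖y‖ ^ 2) * (f y) ^ 2)) (w : E2 → ℝ) (c : ℝ)
    (hw : Continuous w) (hb : ∀ y, |w y| ≤ c * (1 + ‖y‖ ^ 2)) :
    Integrable (fun y : E2 => f y ^ 2 * w y) := by
  refine (h1.const_mul c).mono' ?_ (.of_forall fun y => ?_)
  · have := hf.continuous
    exact (by fun_prop : Continuous _).aestronglyMeasurable
  · rw [norm_mul, Real.norm_eq_abs, Real.norm_eq_abs, abs_of_nonneg (sq_nonneg _)]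
    nlinarith [hb y, sq_nonneg (f y)]

/-- the cutoff weight -/
def phi (ε : ℝ) (y : E2) : ℝ := (1 + ‖y‖ ^ 2) / (1 + ε * ‖y‖ ^ 2)

lemma hasFDerivAt_phi (ε : ℝ) (hε : 0 < ε) (y : E2) :
    HasFDerivAt (phi ε) (((1 - ε) / (1 + ε * ‖y‖ ^ 2) ^ 2 * 2) • innerSL ℝ y) y := by
  have h2 := (hasStrictFDerivAt_norm_sq y).hasFDerivAt
  have hp : 0 < 1 + ε * ‖y‖ ^ 2 := by positivity
  have hd : HasDerivAt (fun s : ℝ => (1 + s) / (1 + ε * s)) ((1 - ε) / (1 + ε * ‖y‖ ^ 2) ^ 2)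
      (‖y‖ ^ 2) := by
    have := ((hasDerivAt_id (‖y‖^2)).const_add 1).div
      (((hasDerivAt_id (‖y‖^2)).const_mul ε).const_add 1) hp.ne'
    refine this.congr_deriv ?_
    simp only [id]
    congr 1
    ring
  have := hd.comp_hasFDerivAt y h2
  refine this.congr_fderiv ?_
  ext v
  simp
  ring

lemma ibp_i (f : E2 → ℝ) (hf : Differentiable ℝ f)
    (h1 : Integrable (fun y : E2 => (1 + ‖y‖ ^ 2) * (f y) ^ 2))
    (h2 : Integrable (fun y : E2 => ‖gradient f y‖ ^ 2 / U2 y))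
    (ε : ℝ) (hε : 0 < ε) (hε1 : ε < 1) (i : Fin 2) :
    Integrable (fun y : E2 => f y ^ 2 * (phi ε y + (1 - ε) / (1 + ε * ‖y‖ ^ 2) ^ 2 * 2 * (y i)^2)) ∧
    Integrable (fun y : E2 => 2 * f y * (gradient f y i) * (phi ε y * y i)) ∧
    ∫ y : E2, f y ^ 2 * (phi ε y + (1 - ε) / (1 + ε * ‖y‖ ^ 2) ^ 2 * 2 * (y i)^2)
      = - ∫ y : E2, 2 * f y * (gradient f y i) * (phi ε y * y i) := by
  have hcphi : Continuous (phi ε) := continuous_iff_continuousAt.2 fun y =>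
    (hasFDerivAt_phi ε hε y).continuousAt
  have hp : ∀ y : E2, 1 ≤ 1 + ε * ‖y‖ ^ 2 := fun y => by nlinarith [sq_nonneg ‖y‖]
  have hyi : ∀ y : E2, |y i| ≤ ‖y‖ := fun y => PiLp.norm_apply_le y i
  have hphi0 : ∀ y, 0 ≤ phi ε y := fun y => by unfold phi; positivity
  have hphi1 : ∀ y, phi ε y ≤ 1 + ‖y‖ ^ 2 := fun y => by
    unfold phi; exact div_le_self (by positivity) (hp y)
  have hphi2 : ∀ y, phi ε y ≤ 1 / ε := fun y => by
    unfold phi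
    rw [div_le_div_iff₀ (by linarith [hp y]) hε]
    nlinarith [sq_nonneg ‖y‖]
  have hyi2 : ∀ y : E2, (y i)^2 ≤ ‖y‖^2 := fun y => sq_le_sq' (by linarith [abs_le.1 (hyi y)]) (abs_le.1 (hyi y)).2
  have I1 : Integrable (fun y : E2 => f y ^ 2 * (phi ε y + (1 - ε) / (1 + ε * ‖y‖ ^ 2) ^ 2 * 2 * (y i)^2)) := by
    apply sq_integrable f hf h1 _ 3
    · have : ∀ y : E2, (1 + ε * ‖y‖ ^ 2) ^ 2 ≠ 0 := fun y => by positivity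
      fun_prop (disch := assumption)
    · intro y
      have ha : (1 - ε) / (1 + ε * ‖y‖ ^ 2) ^ 2 ≤ 1 := by
        rw [div_le_one (by positivity)]
        nlinarith [hp y]
      have ha0 : 0 ≤ (1 - ε) / (1 + ε * ‖y‖ ^ 2) ^ 2 := div_nonneg (by linarith) (by positivity)
      have hh := mul_le_mul ha (hyi2 y) (by positivity) zero_le_one
      rw [abs_of_nonneg (by have := hphi0 y; positivity)]
      nlinarith [hphi1 y, hyi2 y]
  have I2 : Integrable (fun y : E2 => 2 * f y * (gradient f y i) * (phi ε y * y i)) := by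
    refine (((h2.const_mul 4).add h1).const_mul 2).mono' ?_ (.of_forall fun y => ?_)
    · have := hf.continuous.measurable
      have := measurable_grad f
      have := hcphi.measurable
      exact (by fun_prop : Measurable _).aestronglyMeasurable
    · simp only [Pi.add_apply]
      rw [div_U2]
      simp only [norm_mul, Real.norm_eq_abs, abs_of_nonneg (hphi0 y), abs_two]
      have hg : |gradient f y i| ≤ ‖gradient f y‖ := PiLp.norm_apply_le (gradient f y) i
      have : 2 * |f y| * |gradient f y i| * (phi ε y * |y i|) ≤
        2 * |f y| * ‖gradient f y‖ * ((1 + ‖y‖^2) * ‖y‖) := by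
        gcongr
        · exact mul_nonneg (hphi0 y) (abs_nonneg _)
        · exact hphi1 y
        · exact hyi y
      refine this.trans ?_
      have h3 : f y ^ 2 = |f y| ^ 2 := by simp
      rw [h3]
      set g := ‖gradient f y‖
      set r := ‖y‖
      set a := |f y|
      nlinarith [sq_nonneg ((1 + r^2) * g - a * r), sq_nonneg a, sq_nonneg (a*r)]
  refine ⟨I1, I2, ?_⟩
  have I3 : Integrable (fun y : E2 => f y ^ 2 * (phi ε y * y i)) := by
    apply sq_integrable f hf h1 _ (1/ε)
    · fun_prop
    · intro y
      rw [abs_mul, abs_of_nonneg (hphi0 y)]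
      refine mul_le_mul (hphi2 y) ?_ (abs_nonneg _) (by positivity)
      nlinarith [hyi y, sq_nonneg (‖y‖ - 1)]
  have key := integral_bilinear_hasFDerivAt_right_eq_neg_left_of_integrable (μ := (volume : Measure E2))
    (f := fun y => f y ^ 2) (f' := fun y => (2 * f y) • fderiv ℝ f y)
    (g := fun y : E2 => phi ε y * y i)
    (g' := fun y => (phi ε y) • (EuclideanSpace.proj i : E2 →L[ℝ] ℝ) + (y i) • (((1 - ε) / (1 + ε * ‖y‖ ^ 2) ^ 2 * 2) • innerSL ℝ y))
    (v := EuclideanSpace.single i (1:ℝ)) (B := ContinuousLinearMap.mul ℝ ℝ)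
  have e1 : ∀ y : E2, ((2 * f y) • fderiv ℝ f y) (EuclideanSpace.single i (1:ℝ)) =
      2 * f y * gradient f y i := by
    intro y
    have : fderiv ℝ f y (EuclideanSpace.single i (1:ℝ)) = gradient f y i := by
      have h := (hf y).hasGradientAt.hasFDerivAt.fderiv
      rw [h, InnerProductSpace.toDual_apply_apply, EuclideanSpace.inner_single_right]
      simp
    simp [this]
  have e2 : ∀ y : E2, ((phi ε y) • (EuclideanSpace.proj i : E2 →L[ℝ] ℝ) + (y i) • (((1 - ε) / (1 + ε * ‖y‖ ^ 2) ^ 2 * 2) • innerSL ℝ y)) (EuclideanSpace.single i (1:ℝ)) = phi ε y + (1 - ε) / (1 + ε * ‖y‖ ^ 2) ^ 2 * 2 * (y i)^2 := by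
    intro y
    simp [EuclideanSpace.inner_single_right]
    ring
  simp only [ContinuousLinearMap.mul_apply', e1, e2] at key
  refine key I2 I1 I3 ?_ ?_
  · intro y _
    have := (hf y).hasFDerivAt.pow 2
    refine this.congr_fderiv ?_
    ext v; simp
  · intro y _
    exact (hasFDerivAt_phi ε hε y).mul (EuclideanSpace.proj i : E2 →L[ℝ] ℝ).hasFDerivAt

lemma ibp_eps (f : E2 → ℝ) (hf : Differentiable ℝ f)
    (h1 : Integrable (fun y : E2 => (1 + ‖y‖ ^ 2) * (f y) ^ 2))
    (h2 : Integrable (fun y : E2 => ‖gradient f y‖ ^ 2 / U2 y))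
    (ε : ℝ) (hε : 0 < ε) (hε1 : ε < 1) :
    0 ≤ ∫ y : E2, (f y * (1 + ‖y‖ ^ 2) * ⟪y, gradient f y⟫ + f y ^ 2 * (1 + 2 * ‖y‖ ^ 2))
      * (1 / (1 + ε * ‖y‖ ^ 2)) := by
  obtain ⟨a0, b0, c0⟩ := ibp_i f hf h1 h2 ε hε hε1 0
  obtain ⟨a1, b1, c1⟩ := ibp_i f hf h1 h2 ε hε hε1 1
  have hs : ∫ y : E2, ((f y ^ 2 * (phi ε y + (1 - ε) / (1 + ε * ‖y‖ ^ 2) ^ 2 * 2 * (y 0)^2)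
     + f y ^ 2 * (phi ε y + (1 - ε) / (1 + ε * ‖y‖ ^ 2) ^ 2 * 2 * (y 1)^2)) +
     (2 * f y * (gradient f y 0) * (phi ε y * y 0) + 2 * f y * (gradient f y 1) * (phi ε y * y 1))) = 0 := by
    refine (integral_add (a0.add a1) (b0.add b1)).trans ?_
    rw [integral_add' a0 a1, integral_add' b0 b1, c0, c1]
    ring
  have hp : ∀ y : E2, 1 ≤ 1 + ε * ‖y‖ ^ 2 := fun y => by nlinarith [sq_nonneg ‖y‖]
  have hI := (cross_integrable f hf h1 h2).add (sq_integrable f hf h1 (fun y => 1 + 2 * ‖y‖^2) 2 (by fun_prop)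
    (fun y => by rw [abs_of_nonneg (by positivity)]; nlinarith))
  have hI' : Integrable (fun y : E2 => (f y * (1 + ‖y‖ ^ 2) * ⟪y, gradient f y⟫ + f y ^ 2 * (1 + 2 * ‖y‖ ^ 2))
      * (1 / (1 + ε * ‖y‖ ^ 2))) := by
    refine hI.mul_bdd (c := 1) ?_ (.of_forall fun y => ?_)
    · have : ∀ y : E2, (1 + ε * ‖y‖ ^ 2) ≠ 0 := fun y => by positivity
      exact (by fun_prop (disch := assumption) : Continuous _).aestronglyMeasurable
    · rw [Real.norm_of_nonneg (by positivity), div_le_one (by positivity)]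
      exact hp y
  have : (0:ℝ) * (1/2) ≤ ∫ y : E2, (f y * (1 + ‖y‖ ^ 2) * ⟪y, gradient f y⟫ + f y ^ 2 * (1 + 2 * ‖y‖ ^ 2))
      * (1 / (1 + ε * ‖y‖ ^ 2)) := by
    rw [← hs, ← integral_mul_const]
    refine integral_mono (((a0.add a1).add (b0.add b1)).mul_const _) hI' ?_
    intro y
    have hn : ‖y‖^2 = y 0 ^2 + y 1^2 := by simp [EuclideanSpace.norm_sq_eq]
    have hin : ⟪y, gradient f y⟫ = y 0 * gradient f y 0 + y 1 * gradient f y 1 := by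
      rw [PiLp.inner_apply, Fin.sum_univ_two]
      simp [mul_comm]
    have hpy := hp y
    simp only [hin, phi]
    set p := 1 + ε * ‖y‖ ^ 2 with hpdef
    have hq : (1 - ε) / p ^ 2 ≤ 1 / p := by
      rw [div_le_div_iff₀ (by positivity) (by positivity)]
      nlinarith
    have hq2 : f y ^ 2 * ‖y‖^2 * ((1 - ε) / p ^ 2) ≤ f y ^ 2 * ‖y‖^2 * (1 / p) := by gcongr
    rw [hn] at hq2 ⊢
    have : ∀ c : ℝ, c / p = c * (1 / p) := fun c => by ring
    simp only [this (1 + _)]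
    nlinarith
  simpa using this

lemma ibp (f : E2 → ℝ) (hf : Differentiable ℝ f)
    (h1 : Integrable (fun y : E2 => (1 + ‖y‖ ^ 2) * (f y) ^ 2))
    (h2 : Integrable (fun y : E2 => ‖gradient f y‖ ^ 2 / U2 y)) :
    0 ≤ ∫ y : E2, (f y * (1 + ‖y‖ ^ 2) * ⟪y, gradient f y⟫ + f y ^ 2 * (1 + 2 * ‖y‖ ^ 2)) := by
  have hI := (cross_integrable f hf h1 h2).add (sq_integrable f hf h1 (fun y => 1 + 2 * ‖y‖^2) 2 (by fun_prop)
    (fun y => by rw [abs_of_nonneg (by positivity)]; nlinarith))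
  have T := tendsto_integral_of_dominated_convergence (μ := (volume : Measure E2))
    (F := fun (n : ℕ) (y : E2) => (f y * (1 + ‖y‖ ^ 2) * ⟪y, gradient f y⟫ + f y ^ 2 * (1 + 2 * ‖y‖ ^ 2))
      * (1 / (1 + (1 / ((n:ℝ) + 2)) * ‖y‖ ^ 2)))
    (f := fun y => (f y * (1 + ‖y‖ ^ 2) * ⟪y, gradient f y⟫ + f y ^ 2 * (1 + 2 * ‖y‖ ^ 2)) )
    (bound := fun y => ‖(f y * (1 + ‖y‖ ^ 2) * ⟪y, gradient f y⟫ + f y ^ 2 * (1 + 2 * ‖y‖ ^ 2))‖)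
    (fun n => by
      have := hf.continuous.measurable
      have := measurable_grad f
      exact (by fun_prop : Measurable _).aestronglyMeasurable)
    hI.norm
    (fun n => .of_forall fun y => by
      rw [norm_mul]
      refine mul_le_of_le_one_right (norm_nonneg _) ?_
      rw [Real.norm_of_nonneg (by positivity), div_le_one (by positivity)]
      have : 0 ≤ 1 / ((n:ℝ) + 2) * ‖y‖^2 := by positivity
      linarith)
    (.of_forall fun y => by
      have h0 : Filter.Tendsto (fun n : ℕ => 1 / ((n:ℝ) + 2)) Filter.atTop (nhds 0) := by
        have := (tendsto_one_div_add_atTop_nhds_zero_nat (𝕜 := ℝ)).comp (Filter.tendsto_add_atTop_nat 1)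
        refine this.congr fun n => ?_
        simp; ring
      have h3 : Filter.Tendsto (fun n : ℕ => 1 / (1 + (1 / ((n:ℝ) + 2)) * ‖y‖ ^ 2)) Filter.atTop (nhds (1 / (1 + 0 * ‖y‖^2))) := by
        refine Filter.Tendsto.div tendsto_const_nhds ((h0.mul_const _).const_add 1) (by simp)
      simpa using h3.const_mul (f y * (1 + ‖y‖ ^ 2) * ⟪y, gradient f y⟫ + f y ^ 2 * (1 + 2 * ‖y‖ ^ 2)))
  refine ge_of_tendsto' T fun n => ?_
  refine ibp_eps f hf h1 h2 _ (by positivity) ?_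
  rw [div_lt_one (by positivity)]
  have : (0:ℝ) ≤ n := by positivity
  linarith

lemma f2_integrable (f : E2 → ℝ) (hf : Differentiable ℝ f)
    (h1 : Integrable (fun y : E2 => (1 + ‖y‖ ^ 2) * (f y) ^ 2)) : Integrable (fun y : E2 => f y ^ 2) := by
  simpa using sq_integrable f hf h1 (fun _ => 1) 1 (by fun_prop) (fun y => by simp)

lemma partA (f : E2 → ℝ) (hf : Differentiable ℝ f)
    (h1 : Integrable (fun y : E2 => (1 + ‖y‖ ^ 2) * (f y) ^ 2))
    (h2 : Integrable (fun y : E2 => ‖gradient f y‖ ^ 2 / U2 y)) :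
    Integrable (fun y : E2 => U2 y * ‖gradient (fun z => f z / U2 z) y‖ ^ 2) ∧
    (∫ y : E2, ‖gradient f y‖ ^ 2 / U2 y) - ∫ y : E2, f y ^ 2 ≤
      ∫ y : E2, U2 y * ‖gradient (fun z => f z / U2 z) y‖ ^ 2 := by
  have hX := cross_integrable f hf h1 h2
  have hS := sq_integrable f hf h1 (fun y => 1 + 2 * ‖y‖^2) 2 (by fun_prop)
    (fun y => by rw [abs_of_nonneg (by positivity)]; nlinarith)
  have h0 := f2_integrable f hf h1
  have e : (fun y : E2 => U2 y * ‖gradient (fun z => f z / U2 z) y‖ ^ 2) =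
    fun y => (‖gradient f y‖ ^ 2 / U2 y - f y ^ 2) +
      (f y * (1 + ‖y‖ ^ 2) * ⟪y, gradient f y⟫ + f y ^ 2 * (1 + 2 * ‖y‖ ^ 2)) := by
    funext y
    rw [normsq_grad_div f hf]
    ring
  rw [e]
  refine ⟨(h2.sub h0).add (hX.add hS), ?_⟩
  refine le_trans ?_ (integral_add (h2.sub h0) (hX.add hS)).ge
  rw [integral_sub' h2 h0]
  have := ibp f hf h1 h2
  simp only [Pi.add_apply]
  linarith
/-- the local singular kernel -/
def kk : E2 → ℝ := (Metric.ball (0 : E2) 1).indicator (fun z => 1 / (√‖z‖) ^ 3)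

lemma kk_nonneg (z : E2) : 0 ≤ kk z := by
  unfold kk
  exact Set.indicator_nonneg (fun z _ => by positivity) z

lemma kk_meas : Measurable kk := by
  unfold kk
  exact Measurable.indicator (by fun_prop) measurableSet_ball

lemma kk_int : Integrable kk := by
  unfold kk
  rw [integrable_indicator_iff measurableSet_ball]
  refine integrableOn_ball_of_norm_le_rpow (C := 1) (α := 3/2) (by simp) (by simp; norm_num)
    (.of_forall fun z => ?_) (by fun_prop : Measurable _).aestronglyMeasurable
  rw [Real.norm_of_nonneg (by positivity), one_mul, Real.rpow_neg (by positivity), Real.sqrt_eq_rpow,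
    ← Real.rpow_natCast, ← Real.rpow_mul (by positivity)]
  norm_num

lemma kk_int_x (x : E2) : Integrable (fun y => kk (x - y)) := kk_int.comp_sub_left x

/-- either near or far -/
lemma kk_cases (z : E2) : (‖z‖ < 1 ∧ kk z = 1 / (√‖z‖) ^ 3) ∨ (1 ≤ ‖z‖ ∧ kk z = 0) := by
  unfold kk
  by_cases h : ‖z‖ < 1
  · left; exact ⟨h, by rw [Set.indicator_of_mem]; simpa using h⟩
  · right; exact ⟨not_lt.1 h, by rw [Set.indicator_of_notMem]; simpa using h⟩

lemma inv_norm_le (z : E2) : 1 / ‖z‖ ≤ kk z + 1 := by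
  rcases eq_or_ne z 0 with rfl | hz
  · have := kk_nonneg 0; simp; linarith
  have hz' : 0 < ‖z‖ := norm_pos_iff.2 hz
  rcases kk_cases z with ⟨h, e⟩ | ⟨h, e⟩ <;> rw [e]
  · have hq : 0 < √‖z‖ := Real.sqrt_pos.2 hz'
    have hq1 : √‖z‖ ≤ 1 := Real.sqrt_le_one.2 h.le
    have : 1 / ‖z‖ ≤ 1 / √‖z‖ ^ 3 := by
      apply one_div_le_one_div_of_le (by positivity)
      nth_rewrite 2 [← Real.sq_sqrt hz'.le]
      nlinarith [sq_nonneg (√‖z‖)]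
    linarith
  · rw [zero_add, div_le_one hz']; exact h

lemma inv_sqrt_le (z : E2) : 1 / √‖z‖ ≤ kk z + 1 := by
  rcases eq_or_ne z 0 with rfl | hz
  · have := kk_nonneg 0; simp; linarith
  have hz' : 0 < ‖z‖ := norm_pos_iff.2 hz
  have hq : 0 < √‖z‖ := Real.sqrt_pos.2 hz'
  rcases kk_cases z with ⟨h, e⟩ | ⟨h, e⟩ <;> rw [e]
  · have hq1 : √‖z‖ ≤ 1 := Real.sqrt_le_one.2 h.le
    have : 1 / √‖z‖ ≤ 1 / √‖z‖ ^ 3 := by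
      apply one_div_le_one_div_of_le (by positivity)
      exact pow_le_of_le_one hq.le hq1 (by norm_num)
    linarith
  · rw [zero_add, div_le_one hq]; exact Real.one_le_sqrt.2 h

/-- the integrable weight at infinity -/
def ww (z : E2) : ℝ := 1 / √(1 + ‖z‖) ^ 5

lemma ww_nonneg (z : E2) : 0 ≤ ww z := by unfold ww; positivity

lemma ww_meas : Measurable ww := by unfold ww; fun_prop

lemma ww_int : Integrable ww := by
  have := integrable_one_add_norm (E := E2) (μ := volume) (r := 5/2) (by simp; norm_num)
  refine this.congr (.of_forall fun z => ?_)
  unfold ww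
  simp only
  rw [Real.rpow_neg (by positivity), Real.sqrt_eq_rpow,
    ← Real.rpow_natCast, ← Real.rpow_mul (by positivity)]
  norm_num

lemma young (a b : ℝ) (ha : 0 < a) (hb : 0 < b) : 1 / (a ^ 3 * b ^ 2) ≤ 1 / a ^ 5 + 1 / b ^ 5 := by
  rcases le_total a b with h | h
  · have : 1 / (a ^ 3 * b ^ 2) ≤ 1 / a ^ 5 := by
      apply one_div_le_one_div_of_le (by positivity)
      calc a ^ 5 = a ^ 3 * a ^ 2 := by ring
        _ ≤ _ := by gcongr
    have : 0 < 1 / b ^ 5 := by positivity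
    linarith
  · have : 1 / (a ^ 3 * b ^ 2) ≤ 1 / b ^ 5 := by
      apply one_div_le_one_div_of_le (by positivity)
      calc b ^ 5 = b ^ 3 * b ^ 2 := by ring
        _ ≤ _ := by gcongr
    have : 0 < 1 / a ^ 5 := by positivity
    linarith

lemma B_le (z y : E2) : 1 / (√‖z‖ ^ 3 * (1 + ‖y‖)) ≤ kk z + 8 * (ww z + ww y) := by
  rcases eq_or_ne z 0 with rfl | hz
  · have := kk_nonneg 0
    have := ww_nonneg 0
    have := ww_nonneg y
    simp; linarith
  have hz' : 0 < ‖z‖ := norm_pos_iff.2 hz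
  have hq : 0 < √‖z‖ := Real.sqrt_pos.2 hz'
  have h1 := ww_nonneg z
  have h2 := ww_nonneg y
  rcases kk_cases z with ⟨h, e⟩ | ⟨h, e⟩ <;> rw [e]
  · have : 1 / (√‖z‖ ^ 3 * (1 + ‖y‖)) ≤ 1 / √‖z‖ ^ 3 := by
      apply one_div_le_one_div_of_le (by positivity)
      exact le_mul_of_one_le_right (by positivity) (by linarith [norm_nonneg y])
    linarith
  · have ha : 0 < √(1 + ‖z‖) := Real.sqrt_pos.2 (by positivity)
    have hb : 0 < √(1 + ‖y‖) := Real.sqrt_pos.2 (by positivity)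
    have hb2 : √(1 + ‖y‖) ^ 2 = 1 + ‖y‖ := Real.sq_sqrt (by positivity)
    have hle : √(1 + ‖z‖) ≤ 2 * √‖z‖ := by
      apply Real.sqrt_le_iff.2 ⟨by positivity, ?_⟩
      rw [mul_pow, Real.sq_sqrt hz'.le]; linarith
    have hy := young _ _ ha hb
    have : 1 / (√‖z‖ ^ 3 * (1 + ‖y‖)) ≤ 8 * (1 / (√(1 + ‖z‖) ^ 3 * √(1 + ‖y‖) ^ 2)) := by
      rw [hb2, ← div_eq_mul_one_div, div_le_div_iff₀ (by positivity) (by positivity)]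
      have h3 : √(1 + ‖z‖) ^ 3 ≤ (2 * √‖z‖) ^ 3 := by gcongr
      have : 0 < 1 + ‖y‖ := by positivity
      nlinarith
    unfold ww
    linarith

lemma lint_B : ∃ K : ℝ, 0 ≤ K ∧ ∀ x : E2,
    ∫⁻ y : E2, ENNReal.ofReal (1 / (√‖x - y‖ ^ 3 * (1 + ‖y‖))) ≤ ENNReal.ofReal K := by
  refine ⟨(∫ z, kk z) + 8 * ((∫ z, ww z) + ∫ z, ww z), ?_, fun x => ?_⟩
  · have := integral_nonneg (μ := (volume : Measure E2)) (f := kk) (fun z => kk_nonneg z)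
    have := integral_nonneg (μ := (volume : Measure E2)) (f := ww) (fun z => ww_nonneg z)
    positivity
  · have hw : Integrable (fun y => ww (x - y)) := ww_int.comp_sub_left x
    have hI : Integrable (fun y : E2 => kk (x - y) + 8 * (ww (x - y) + ww y)) :=
      (kk_int_x x).add ((hw.add ww_int).const_mul 8)
    have e : ∫ y : E2, (kk (x - y) + 8 * (ww (x - y) + ww y)) = (∫ z, kk z) + 8 * ((∫ z, ww z) + ∫ z, ww z) := by
      refine (integral_add (kk_int_x x) ((hw.add ww_int).const_mul 8)).trans ?_
      rw [integral_const_mul, integral_add' hw ww_int,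
        integral_sub_left_eq_self kk, integral_sub_left_eq_self ww]
    rw [← e, ofReal_integral_eq_lintegral_ofReal hI]
    · exact lintegral_mono fun y => ENNReal.ofReal_le_ofReal (B_le _ _)
    · exact .of_forall fun y => add_nonneg (kk_nonneg _) (mul_nonneg (by norm_num) (add_nonneg (ww_nonneg _) (ww_nonneg _)))

lemma U2_le (x : E2) : U2 x ≤ 8 := by
  unfold U2
  apply div_le_self (by norm_num)
  nlinarith [sq_nonneg ‖x‖]

lemma U2_cont : Continuous U2 := by
  unfold U2
  have : ∀ y : E2, (1 + ‖y‖ ^ 2) ^ 2 ≠ 0 := fun y => by positivity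
  fun_prop (disch := assumption)

lemma U2_int : Integrable U2 := by
  have := integrable_rpow_neg_one_add_norm_sq (E := E2) (μ := volume) (r := 4) (by simp; norm_num)
  refine (this.const_mul 8).congr (.of_forall fun z => ?_)
  unfold U2
  simp only
  rw [show (-4/2 : ℝ) = -(2:ℕ) by norm_num, Real.rpow_neg (by positivity), Real.rpow_natCast]
  rfl

lemma lint_A : ∃ K : ℝ, 0 ≤ K ∧ ∀ y : E2,
    ∫⁻ x : E2, ENNReal.ofReal (U2 x * (1 / √‖x - y‖)) ≤ ENNReal.ofReal K := by
  refine ⟨8 * (∫ z, kk z) + ∫ z, U2 z, ?_, fun y => ?_⟩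
  · have := integral_nonneg (μ := (volume : Measure E2)) (f := kk) (fun z => kk_nonneg z)
    have := integral_nonneg (μ := (volume : Measure E2)) (f := U2) (fun z => (U2_pos z).le)
    positivity
  · have hk : Integrable (fun x => kk (x - y)) := kk_int.comp_sub_right y
    have e : ∫ x : E2, (8 * kk (x - y) + U2 x) = 8 * (∫ z, kk z) + ∫ z, U2 z := by
      rw [integral_add (hk.const_mul 8) U2_int, integral_const_mul, integral_sub_right_eq_self kk]
    have hI : Integrable (fun x => 8 * kk (x - y) + U2 x) := (hk.const_mul 8).add U2_int
    rw [← e, ofReal_integral_eq_lintegral_ofReal hI]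
    · refine lintegral_mono fun x => ENNReal.ofReal_le_ofReal ?_
      have h1 := inv_sqrt_le (x - y)
      have h2 := U2_le x
      have h3 := U2_pos x
      have h4 := kk_nonneg (x - y)
      calc U2 x * (1 / √‖x - y‖) ≤ U2 x * (kk (x - y) + 1) := by gcongr
        _ ≤ _ := by nlinarith
    · exact .of_forall fun x => add_nonneg (mul_nonneg (by norm_num) (kk_nonneg _)) (U2_pos x).le

lemma cs (f : E2 → ℝ) (hf : Measurable f) (K : ℝ)
    (hK : ∀ x : E2, ∫⁻ y : E2, ENNReal.ofReal (1 / (√‖x - y‖ ^ 3 * (1 + ‖y‖))) ≤ ENNReal.ofReal K) (x : E2) :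
    (∫⁻ y : E2, ENNReal.ofReal (|f y| * (1 / ‖x - y‖))) ^ 2 ≤
      ENNReal.ofReal K * ∫⁻ y : E2, ENNReal.ofReal ((1 + ‖y‖) * f y ^ 2 * (1 / √‖x - y‖)) := by
  set a : E2 → ENNReal := fun y => ENNReal.ofReal (√((1 + ‖y‖) * f y ^ 2 * (1 / √‖x - y‖)))
  set b : E2 → ENNReal := fun y => ENNReal.ofReal (√(1 / (√‖x - y‖ ^ 3 * (1 + ‖y‖))))
  have h := ENNReal.lintegral_mul_le_Lp_mul_Lq (volume : Measure E2) Real.HolderConjugate.two_two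
    (f := a) (g := b) (by fun_prop) (by fun_prop)
  have e1 : ∫⁻ y : E2, ENNReal.ofReal (|f y| * (1 / ‖x - y‖)) = ∫⁻ y, (a * b) y := by
    congr 1
    funext y
    simp only [Pi.mul_apply, a, b]
    rw [← ENNReal.ofReal_mul (by positivity), ← Real.sqrt_mul (by positivity)]
    congr 1
    symm
    rw [Real.sqrt_eq_iff_mul_self_eq (by positivity) (by positivity)]
    rcases eq_or_ne (x - y) 0 with hz | hz
    · simp [hz]
    have hz' : 0 < ‖x - y‖ := norm_pos_iff.2 hz
    have hq : 0 < √‖x - y‖ := Real.sqrt_pos.2 hz'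
    have hq2 := Real.sq_sqrt hz'.le
    rw [← hq2]
    simp only [Real.sqrt_sq hq.le]
    have : 0 < 1 + ‖y‖ := by positivity
    field_simp
    simp
  have e2 : ∀ c : E2 → ℝ, (∀ y, 0 ≤ c y) → ∀ y, ENNReal.ofReal (√ (c y)) ^ (2:ℝ) = ENNReal.ofReal (c y) := by
    intro c hc y
    rw [ENNReal.ofReal_rpow_of_nonneg (by positivity) (by norm_num)]
    congr 1
    rw [Real.rpow_two, Real.sq_sqrt (hc y)]
  rw [e1]
  have h' : (∫⁻ y, (a * b) y) ^ 2 ≤ (∫⁻ y, a y ^ (2:ℝ)) * ∫⁻ y, b y ^ (2:ℝ) := by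
    refine (pow_le_pow_left' h 2).trans_eq ?_
    rw [mul_pow, ← ENNReal.rpow_two, ← ENNReal.rpow_two, ← ENNReal.rpow_mul, ← ENNReal.rpow_mul]
    norm_num
  refine h'.trans ?_
  rw [mul_comm]
  refine mul_le_mul' ?_ ?_
  · refine le_trans (le_of_eq ?_) (hK x)
    congr 1; funext y
    exact e2 (fun y => 1 / (√‖x - y‖ ^ 3 * (1 + ‖y‖))) (fun y => by positivity) y
  · apply le_of_eq
    congr 1; funext y
    exact e2 (fun y => (1 + ‖y‖) * f y ^ 2 * (1 / √‖x - y‖)) (fun y => by positivity) y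

lemma partB : ∃ K : ℝ, 0 ≤ K ∧ ∀ (f : E2 → ℝ) (P : E2 → E2), Measurable f → Measurable P →
    Integrable (fun y : E2 => (1 + ‖y‖) * f y ^ 2) →
    (∀ x, ENNReal.ofReal ‖P x‖ ≤ ∫⁻ y : E2, ENNReal.ofReal (|f y| * (1 / ‖x - y‖))) →
    Integrable (fun x => U2 x * ‖P x‖ ^ 2) ∧
      ∫ x, U2 x * ‖P x‖ ^ 2 ≤ K * ∫ y : E2, (1 + ‖y‖) * f y ^ 2 := by
  obtain ⟨K, hK0, hK⟩ := lint_B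
  obtain ⟨L, hL0, hL⟩ := lint_A
  refine ⟨K * L, by positivity, fun f P hf hP hI hb => ?_⟩
  have hU := U2_cont.measurable
  have main : ∫⁻ x, ENNReal.ofReal (U2 x * ‖P x‖ ^ 2) ≤
      ENNReal.ofReal (K * L * ∫ y : E2, (1 + ‖y‖) * f y ^ 2) := by
    calc ∫⁻ x, ENNReal.ofReal (U2 x * ‖P x‖ ^ 2)
        ≤ ∫⁻ x, ENNReal.ofReal K * ∫⁻ y, ENNReal.ofReal (U2 x * ((1 + ‖y‖) * f y ^ 2 * (1 / √‖x - y‖))) := by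
          refine lintegral_mono fun x => ?_
          simp only [ENNReal.ofReal_mul (U2_pos x).le]
          rw [lintegral_const_mul _ (by fun_prop), mul_left_comm]
          refine mul_le_mul' le_rfl ?_
          rw [ENNReal.ofReal_pow (norm_nonneg _)]
          exact (pow_le_pow_left' (hb x) 2).trans (cs f hf K hK x)
      _ = ENNReal.ofReal K * ∫⁻ y, ∫⁻ x, ENNReal.ofReal (U2 x * ((1 + ‖y‖) * f y ^ 2 * (1 / √‖x - y‖))) := by
          rw [lintegral_const_mul' _ _ (by simp), lintegral_lintegral_swap]
          exact (by fun_prop : Measurable _).aemeasurable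
      _ ≤ ENNReal.ofReal K * ∫⁻ y, ENNReal.ofReal L * ENNReal.ofReal ((1 + ‖y‖) * f y ^ 2) := by
          gcongr with y
          have : ∀ x, ENNReal.ofReal (U2 x * ((1 + ‖y‖) * f y ^ 2 * (1 / √‖x - y‖))) =
              ENNReal.ofReal (U2 x * (1 / √‖x - y‖)) * ENNReal.ofReal ((1 + ‖y‖) * f y ^ 2) := by
            intro x
            rw [← ENNReal.ofReal_mul (mul_nonneg (U2_pos x).le (by positivity))]
            congr 1; ring
          simp only [this]
          rw [lintegral_mul_const' _ _ (by simp)]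
          gcongr
          exact hL y
      _ = _ := by
          rw [lintegral_const_mul' _ _ (by simp), ← ofReal_integral_eq_lintegral_ofReal hI (.of_forall fun y => by positivity),
            ← ENNReal.ofReal_mul hL0, ← ENNReal.ofReal_mul hK0, mul_assoc]
  have hnn : ∀ x, 0 ≤ U2 x * ‖P x‖ ^ 2 := fun x => mul_nonneg (U2_pos x).le (by positivity)
  have hint : Integrable (fun x => U2 x * ‖P x‖ ^ 2) := by
    refine ⟨(by fun_prop : Measurable _).aestronglyMeasurable, ?_⟩
    rw [hasFiniteIntegral_iff_ofReal (.of_forall hnn)]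
    exact main.trans_lt ENNReal.ofReal_lt_top
  refine ⟨hint, ?_⟩
  rw [← ofReal_integral_eq_lintegral_ofReal hint (.of_forall hnn)] at main
  refine (ENNReal.ofReal_le_ofReal_iff ?_).1 main
  exact mul_nonneg (by positivity) (integral_nonneg fun y => by positivity)
lemma f_int (f : E2 → ℝ) (hf : Continuous f) (x0 : E2)
    (h : Integrable (fun y : E2 => Real.log ‖x0 - y‖ * f y)) : Integrable f := by
  have h1 : Integrable ((Metric.closedBall x0 3).indicator f) := by
    rw [integrable_indicator_iff Metric.isClosed_closedBall.measurableSet]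
    exact hf.continuousOn.integrableOn_compact (isCompact_closedBall x0 3)
  refine (h.norm.add h1.norm).mono' hf.aestronglyMeasurable (.of_forall fun y => ?_)
  simp only [Pi.add_apply]
  by_cases hy : y ∈ Metric.closedBall x0 3
  · rw [Set.indicator_of_mem hy]
    linarith [norm_nonneg (Real.log ‖x0 - y‖ * f y)]
  · rw [Set.indicator_of_notMem hy, norm_zero, add_zero, norm_mul]
    apply le_mul_of_one_le_left (norm_nonneg _)
    rw [Metric.mem_closedBall, not_le, dist_comm, dist_eq_norm] at hy
    refine le_trans ?_ (le_abs_self _)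
    rw [Real.le_log_iff_exp_le (by linarith)]
    linarith [Real.exp_one_lt_d9]

lemma kkf_le (f : E2 → ℝ) (x x0 : E2) (M : ℝ) (hx : ‖x - x0‖ ≤ 1)
    (hM : ∀ y ∈ Metric.closedBall x0 2, ‖f y‖ ≤ M) (y : E2) :
    kk (x - y) * ‖f y‖ ≤ M * kk (x - y) := by
  rcases kk_cases (x - y) with ⟨h, e⟩ | ⟨h, e⟩
  · rw [mul_comm M]
    refine mul_le_mul_of_nonneg_left (hM y ?_) (kk_nonneg _)
    rw [Metric.mem_closedBall, dist_eq_norm]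
    have : y - x0 = (x - x0) - (x - y) := by abel
    rw [this]
    linarith [norm_sub_le (x - x0) (x - y)]
  · rw [e]; simp

lemma exists_M (f : E2 → ℝ) (hf : Continuous f) (x0 : E2) :
    ∃ M, ∀ y ∈ Metric.closedBall x0 2, ‖f y‖ ≤ M :=
  (isCompact_closedBall x0 2).exists_bound_of_continuousOn hf.continuousOn

lemma kkf_int (f : E2 → ℝ) (hf : Continuous f) (x : E2) :
    Integrable (fun y : E2 => kk (x - y) * ‖f y‖) := by
  obtain ⟨M, hM⟩ := exists_M f hf x
  refine ((kk_int_x x).const_mul M).mono' ?_ (.of_forall fun y => ?_)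
  · have := kk_meas
    have := hf.measurable
    exact (by fun_prop : Measurable _).aestronglyMeasurable
  · rw [Real.norm_of_nonneg (mul_nonneg (kk_nonneg _) (norm_nonneg _))]
    exact kkf_le f x x M (by simp) hM y

lemma log_le (x x0 y : E2) :
    |Real.log ‖x - y‖| ≤ kk (x - y) + |Real.log ‖x0 - y‖| + (1 + Real.log (1 + ‖x - x0‖)) := by
  have hd : 0 ≤ Real.log (1 + ‖x - x0‖) := Real.log_nonneg (by linarith [norm_nonneg (x - x0)])
  have h0 := abs_nonneg (Real.log ‖x0 - y‖)
  rcases kk_cases (x - y) with ⟨h, e⟩ | ⟨h, e⟩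
  · have h1 : |Real.log ‖x - y‖| ≤ 1 / ‖x - y‖ := by
      rcases eq_or_ne (x - y) 0 with hz | hz
      · simp [hz]
      have hz' : 0 < ‖x - y‖ := norm_pos_iff.2 hz
      rw [abs_of_nonpos (Real.log_nonpos hz'.le h.le), ← Real.log_inv, one_div]
      have := Real.log_le_sub_one_of_pos (inv_pos.2 hz')
      linarith
    linarith [inv_norm_le (x - y)]
  · rw [e, abs_of_nonneg (Real.log_nonneg h)]
    have htri : ‖x - y‖ ≤ ‖x - x0‖ + ‖x0 - y‖ := norm_sub_le_norm_sub_add_norm_sub x x0 y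
    have h2 : ‖x - y‖ ≤ (1 + ‖x - x0‖) * (1 + ‖x0 - y‖) := by
      nlinarith [norm_nonneg (x - x0), norm_nonneg (x0 - y)]
    have h3 := Real.log_le_log (by linarith) h2
    rw [Real.log_mul (by positivity) (by positivity)] at h3
    have h4 : Real.log (1 + ‖x0 - y‖) ≤ |Real.log ‖x0 - y‖| + 1 := by
      have hl2 := Real.log_two_lt_d9
      rcases le_total 1 ‖x0 - y‖ with h5 | h5
      · have h6 : Real.log (1 + ‖x0 - y‖) ≤ Real.log (2 * ‖x0 - y‖) :=
          Real.log_le_log (by positivity) (by linarith)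
        rw [Real.log_mul (by norm_num) (by positivity)] at h6
        linarith [le_abs_self (Real.log ‖x0 - y‖)]
      · have h6 : Real.log (1 + ‖x0 - y‖) ≤ Real.log 2 :=
          Real.log_le_log (by positivity) (by linarith)
        linarith
    linarith

lemma logf_int (f : E2 → ℝ) (hf : Continuous f) (x0 : E2)
    (h : Integrable (fun y : E2 => Real.log ‖x0 - y‖ * f y)) (x : E2) :
    Integrable (fun y : E2 => Real.log ‖x - y‖ * f y) := by
  have h1 := f_int f hf x0 h
  refine (((kkf_int f hf x).add h.norm).add (h1.norm.const_mul (1 + Real.log (1 + ‖x - x0‖)))).mono'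
    ?_ (.of_forall fun y => ?_)
  · have := hf.measurable
    exact (by fun_prop : Measurable _).aestronglyMeasurable
  · simp only [Pi.add_apply, norm_mul]
    rw [← add_mul, ← add_mul]
    exact mul_le_mul_of_nonneg_right (log_le x x0 y) (norm_nonneg _)

/-- regularised logarithm -/
def Lr (d : ℝ) (z : E2) : ℝ := (1/2) * Real.log (‖z‖ ^ 2 + d ^ 4)

lemma Lr_le (d : ℝ) (hd : 0 < d) (hd1 : d ≤ 1) (z : E2) (hz : z ≠ 0) :
    |Lr d z| ≤ |Real.log ‖z‖| + 1 := by
  have hz' : 0 < ‖z‖ := norm_pos_iff.2 hz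
  have hd4 : d ^ 4 ≤ 1 := pow_le_one₀ hd.le hd1
  have hlow : Real.log ‖z‖ ≤ Lr d z := by
    have : Real.log (‖z‖^2) ≤ Real.log (‖z‖ ^ 2 + d ^ 4) := Real.log_le_log (by positivity) (by have := pow_pos hd 4; linarith)
    rw [Real.log_pow] at this
    push_cast at this
    unfold Lr; linarith
  have hup : Lr d z ≤ |Real.log ‖z‖| + 1 := by
    have hl2 := Real.log_two_lt_d9
    unfold Lr
    rcases le_total 1 ‖z‖ with h5 | h5
    · have h6 : Real.log (‖z‖ ^ 2 + d ^ 4) ≤ Real.log (2 * ‖z‖^2) :=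
        Real.log_le_log (by positivity) (by nlinarith)
      rw [Real.log_mul (by norm_num) (by positivity), Real.log_pow] at h6
      push_cast at h6
      linarith [le_abs_self (Real.log ‖z‖)]
    · have h6 : Real.log (‖z‖ ^ 2 + d ^ 4) ≤ Real.log 2 :=
        Real.log_le_log (by positivity) (by nlinarith)
      linarith [abs_nonneg (Real.log ‖z‖)]
  rw [abs_le]
  exact ⟨by linarith [neg_abs_le (Real.log ‖z‖)], hup⟩

lemma Lr_cont (d : ℝ) (hd : 0 < d) : Continuous (Lr d) := by
  unfold Lr
  have : ∀ z : E2, ‖z‖ ^ 2 + d ^ 4 ≠ 0 := fun z => by positivity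
  fun_prop (disch := assumption)

lemma Lr_deriv (d : ℝ) (hd : 0 < d) (z : E2) :
    HasFDerivAt (Lr d) ((1 / (‖z‖ ^ 2 + d ^ 4)) • innerSL ℝ z) z := by
  have h2 := (hasStrictFDerivAt_norm_sq z).hasFDerivAt
  have := ((h2.add_const (d ^ 4)).log (by positivity)).const_mul (1/2)
  refine this.congr_fderiv ?_
  ext v
  simp
  ring

lemma ae_ne (x : E2) : ∀ᵐ y : E2, x - y ≠ 0 := by
  have : ∀ᵐ y : E2, y ≠ x := by simp [ae_iff, measure_singleton]
  filter_upwards [this] with y hy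
  exact sub_ne_zero.2 hy.symm

lemma Lrf_int (f : E2 → ℝ) (hf : Continuous f) (d : ℝ) (hd : 0 < d) (hd1 : d ≤ 1) (h1 : Integrable f)
    (x : E2) (h : Integrable (fun y : E2 => Real.log ‖x - y‖ * f y)) :
    Integrable (fun y : E2 => Lr d (x - y) * f y) := by
  refine (h.norm.add h1.norm).mono' ?_ ?_
  · have := Lr_cont d hd
    exact (by fun_prop : Continuous _).aestronglyMeasurable
  · filter_upwards [ae_ne x] with y hy
    simp only [Pi.add_apply, norm_mul]
    have := Lr_le d hd hd1 _ hy
    have h0 := norm_nonneg (f y)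
    simp only [Real.norm_eq_abs] at *
    nlinarith

/-- derivative kernel -/
def Kr (d : ℝ) (z : E2) : E2 →L[ℝ] ℝ := (1 / (‖z‖ ^ 2 + d ^ 4)) • innerSL ℝ z

lemma Kr_norm (d : ℝ) (z : E2) : ‖Kr d z‖ = 1 / (‖z‖ ^ 2 + d ^ 4) * ‖z‖ := by
  unfold Kr
  rw [norm_smul, innerSL_apply_norm, Real.norm_of_nonneg (by positivity)]

lemma Kr_meas (d : ℝ) : Measurable (Kr d) := by
  unfold Kr
  have : Measurable (fun z : E2 => innerSL ℝ z) := (innerSL ℝ (E := E2)).continuous.measurable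
  have h2 : Measurable (fun z : E2 => 1 / (‖z‖ ^ 2 + d ^ 4)) := by fun_prop
  exact h2.smul this

lemma Kr_diff (d : ℝ) (hd : 0 < d) (hd1 : d ≤ 1) (z : E2) :
    ‖Kr d z - Kr 0 z‖ ≤ d * (kk z + 1) := by
  rcases eq_or_ne z 0 with rfl | hz
  · have := kk_nonneg 0
    simp [Kr]; positivity
  have hz' : 0 < ‖z‖ := norm_pos_iff.2 hz
  have e : ‖Kr d z - Kr 0 z‖ = d ^ 4 / (‖z‖ * (‖z‖ ^ 2 + d ^ 4)) := by
    unfold Kr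
    have e0 : (1 / (‖z‖ ^ 2 + d ^ 4)) • innerSL ℝ z - (1 / (‖z‖ ^ 2 + 0 ^ 4)) • innerSL ℝ z =
        (1 / (‖z‖ ^ 2 + d ^ 4) - 1 / (‖z‖ ^ 2 + 0 ^ 4)) • innerSL ℝ z := by
      ext v; simp; ring
    rw [e0, norm_smul, innerSL_apply_norm, Real.norm_eq_abs, abs_sub_comm, abs_of_nonneg]
    · field_simp
      ring
    · rw [sub_nonneg]
      apply one_div_le_one_div_of_le (by positivity)
      simp; positivity
  rw [e]
  rcases kk_cases z with ⟨h, e⟩ | ⟨h, e⟩ <;> rw [e]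
  · have hq : 0 < √‖z‖ := Real.sqrt_pos.2 hz'
    have hq2 := Real.sq_sqrt hz'.le
    set q := √‖z‖
    rw [← hq2]
    have : d ^ 4 / (q ^ 2 * ((q ^ 2) ^ 2 + d ^ 4)) ≤ d * (1 / q ^ 3) := by
      rw [← div_eq_mul_one_div, div_le_div_iff₀ (by positivity) (by positivity)]
      have h1 : d ^ 3 * q ≤ q ^ 4 + d ^ 4 := by
        rcases le_total d q with h | h
        · have : d ^ 3 * q ≤ q ^ 3 * q := by gcongr
          nlinarith [pow_pos hd 4]
        · have : d ^ 3 * q ≤ d ^ 3 * d := by gcongr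
          nlinarith [pow_pos hq 4]
      have : (d * q ^ 2) * (d ^ 3 * q) ≤ (d * q ^ 2) * (q ^ 4 + d ^ 4) := by gcongr
      nlinarith
    linarith
  · rw [div_le_iff₀ (by positivity)]
    have h1 : 1 ≤ ‖z‖ * (‖z‖ ^ 2 + d ^ 4) := by
      have := pow_pos hd 4
      nlinarith [sq_nonneg (‖z‖ - 1)]
    have h2 : d ^ 4 ≤ d := by
      calc d ^ 4 = d ^ 3 * d := by ring
        _ ≤ 1 * d := by gcongr; exact pow_le_one₀ hd.le hd1
        _ = d := one_mul d
    nlinarith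

lemma Kr0_norm (z : E2) : ‖Kr 0 z‖ = 1 / ‖z‖ := by
  rw [Kr_norm]
  rcases eq_or_ne z 0 with rfl | hz
  · simp
  have hz' : 0 < ‖z‖ := norm_pos_iff.2 hz
  simp; field_simp

lemma Krf_meas (f : E2 → ℝ) (hf : Continuous f) (d : ℝ) (x : E2) :
    AEStronglyMeasurable (fun y : E2 => f y • Kr d (x - y)) := by
  have h1 : Measurable (fun y : E2 => Kr d (x - y)) := (Kr_meas d).comp (by fun_prop)
  exact (hf.measurable.smul h1).aestronglyMeasurable

lemma Kr0f_int (f : E2 → ℝ) (hf : Continuous f) (h1 : Integrable f) (x : E2) :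
    Integrable (fun y : E2 => f y • Kr 0 (x - y)) := by
  refine ((kkf_int f hf x).add h1.norm).mono' (Krf_meas f hf 0 x) (.of_forall fun y => ?_)
  rw [norm_smul, Kr0_norm]
  simp only [Pi.add_apply]
  nlinarith [inv_norm_le (x - y), norm_nonneg (f y)]

lemma Kr_le (d : ℝ) (hd : 0 < d) (z : E2) : ‖Kr d z‖ ≤ 1 / d ^ 2 := by
  rw [Kr_norm, one_div_mul_eq_div]
  rw [div_le_div_iff₀ (by positivity) (by positivity)]
  nlinarith [sq_nonneg (‖z‖ - d ^ 2), norm_nonneg z, sq_nonneg d, mul_nonneg (norm_nonneg z) (sq_nonneg d)]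

lemma Krf_int (f : E2 → ℝ) (hf : Continuous f) (h1 : Integrable f) (d : ℝ) (hd : 0 < d) (x : E2) :
    Integrable (fun y : E2 => f y • Kr d (x - y)) := by
  refine (h1.norm.const_mul (1 / d ^ 2)).mono' (Krf_meas f hf d x) (.of_forall fun y => ?_)
  rw [norm_smul, mul_comm]
  exact mul_le_mul_of_nonneg_right (Kr_le d hd _) (norm_nonneg _)

lemma reg_deriv (f : E2 → ℝ) (hf : Continuous f) (h1 : Integrable f)
    (h : ∀ x, Integrable (fun y : E2 => Real.log ‖x - y‖ * f y)) (d : ℝ) (hd : 0 < d) (hd1 : d ≤ 1) (x : E2) :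
    HasFDerivAt (fun x => ∫ y : E2, Lr d (x - y) * f y) (∫ y : E2, f y • Kr d (x - y)) x := by
  refine hasFDerivAt_integral_of_dominated_of_fderiv_le (s := Set.univ) (bound := fun y => 1 / d ^ 2 * ‖f y‖)
    (F' := fun x y => f y • Kr d (x - y)) Filter.univ_mem
    (.of_forall fun x => (Lrf_int f hf d hd hd1 h1 x (h x)).1) (Lrf_int f hf d hd hd1 h1 x (h x))
    (Krf_meas f hf d x) (.of_forall fun y x _ => ?_) (h1.norm.const_mul _) (.of_forall fun y x _ => ?_)
  · rw [norm_smul, mul_comm]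
    exact mul_le_mul_of_nonneg_right (Kr_le d hd _) (norm_nonneg _)
  · have h2 : HasFDerivAt (fun x : E2 => x - y) (ContinuousLinearMap.id ℝ E2) x := (hasFDerivAt_id x).sub_const y
    have := ((Lr_deriv d hd (x - y)).comp x h2).mul_const (f y)
    exact this

lemma log_deriv (f : E2 → ℝ) (hf : Continuous f) (h1 : Integrable f)
    (h : ∀ x, Integrable (fun y : E2 => Real.log ‖x - y‖ * f y)) (x0 : E2) :
    HasFDerivAt (fun x => ∫ y : E2, Real.log ‖x - y‖ * f y) (∫ y : E2, f y • Kr 0 (x0 - y)) x0 := by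
  obtain ⟨M, hM⟩ := exists_M f hf x0
  have hd : ∀ n : ℕ, 0 < 1 / ((n:ℝ) + 1) := fun n => by positivity
  have hd1 : ∀ n : ℕ, 1 / ((n:ℝ) + 1) ≤ 1 := fun n => by
    rw [div_le_one (by positivity)]; linarith [(Nat.cast_nonneg n : (0:ℝ) ≤ n)]
  have ht := tendsto_one_div_add_atTop_nhds_zero_nat (𝕜 := ℝ)
  refine hasFDerivAt_of_tendstoLocallyUniformlyOn (l := Filter.atTop) (s := Metric.ball x0 1)
    (f := fun (n : ℕ) x => ∫ y : E2, Lr (1 / ((n:ℝ) + 1)) (x - y) * f y)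
    (f' := fun (n : ℕ) x => ∫ y : E2, f y • Kr (1 / ((n:ℝ) + 1)) (x - y))
    (g' := fun x => ∫ y : E2, f y • Kr 0 (x - y))
    Metric.isOpen_ball ?_ (fun n x _ => reg_deriv f hf h1 h _ (hd n) (hd1 n) x) ?_ (by simp)
  · apply TendstoUniformlyOn.tendstoLocallyUniformlyOn
    rw [Metric.tendstoUniformlyOn_iff]
    intro ε hε
    set c := M * (∫ z, kk z) + ∫ y, ‖f y‖ with hc
    have ht2 : Filter.Tendsto (fun n : ℕ => 1 / ((n:ℝ) + 1) * c) Filter.atTop (nhds 0) := by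
      simpa using ht.mul_const c
    filter_upwards [ht2.eventually_lt_const hε] with n hn x hx
    refine lt_of_le_of_lt ?_ hn
    rw [dist_comm, dist_eq_norm, ← integral_sub (Krf_int f hf h1 _ (hd n) x) (Kr0f_int f hf h1 x)]
    have hI : Integrable (fun y => 1 / ((n:ℝ) + 1) * (M * kk (x - y) + ‖f y‖)) :=
      (((kk_int_x x).const_mul M).add h1.norm).const_mul _
    have hx' : ‖x - x0‖ ≤ 1 := by rw [← dist_eq_norm]; exact (Metric.mem_ball.1 hx).le
    refine (norm_integral_le_of_norm_le hI (.of_forall fun y => ?_)).trans_eq ?_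
    · have e0 : f y • Kr (1 / ((n:ℝ) + 1)) (x - y) - f y • Kr 0 (x - y) =
          f y • (Kr (1 / ((n:ℝ) + 1)) (x - y) - Kr 0 (x - y)) := by
        ext v; simp; ring
      rw [e0, norm_smul]
      have h3 := Kr_diff _ (hd n) (hd1 n) (x - y)
      have h4 := kkf_le f x x0 M hx' hM y
      calc ‖f y‖ * ‖Kr (1 / ((n:ℝ) + 1)) (x - y) - Kr 0 (x - y)‖
          ≤ ‖f y‖ * (1 / ((n:ℝ) + 1) * (kk (x - y) + 1)) := by gcongr
        _ = 1 / ((n:ℝ) + 1) * (kk (x - y) * ‖f y‖ + ‖f y‖) := by ring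
        _ ≤ _ := by
          have := hd n
          gcongr
    · rw [integral_const_mul, integral_add ((kk_int_x x).const_mul M) h1.norm, integral_const_mul,
        integral_sub_left_eq_self kk]
  · intro x _
    refine tendsto_integral_of_dominated_convergence (fun y => ‖Real.log ‖x - y‖ * f y‖ + ‖f y‖)
      (fun n => (Lrf_int f hf _ (hd n) (hd1 n) h1 x (h x)).1) ((h x).norm.add h1.norm) (fun n => ?_) ?_
    · filter_upwards [ae_ne x] with y hy
      simp only [norm_mul]
      have := Lr_le _ (hd n) (hd1 n) _ hy
      have h0 := norm_nonneg (f y)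
      simp only [Real.norm_eq_abs] at *
      nlinarith
    · filter_upwards [ae_ne x] with y hy
      apply Filter.Tendsto.mul_const
      have hz' : 0 < ‖x - y‖ := norm_pos_iff.2 hy
      have h5 : Filter.Tendsto (fun n : ℕ => (1/2) * Real.log (‖x - y‖ ^ 2 + (1 / ((n:ℝ) + 1)) ^ 4)) Filter.atTop
          (nhds ((1/2) * Real.log (‖x - y‖ ^ 2 + 0 ^ 4))) := by
        apply Filter.Tendsto.const_mul
        apply Filter.Tendsto.log _ (by positivity)
        exact (ht.pow 4).const_add _
      have e : (1/2) * Real.log (‖x - y‖ ^ 2 + 0 ^ 4) = Real.log ‖x - y‖ := by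
        simp [Real.log_pow]
      rw [e] at h5
      exact h5

lemma partC (f : E2 → ℝ) (hf : Continuous f) :
    Differentiable ℝ (Psi f) ∧ ∀ x, ENNReal.ofReal ‖gradient (Psi f) x‖ ≤
      ∫⁻ y : E2, ENNReal.ofReal (|f y| * (1 / ‖x - y‖)) := by
  by_cases hex : ∃ x0, Integrable (fun y : E2 => Real.log ‖x0 - y‖ * f y)
  · obtain ⟨x0, h0⟩ := hex
    have h1 := f_int f hf x0 h0
    have hd := fun x => (log_deriv f hf h1 (logf_int f hf x0 h0) x).const_mul (-(1 / (2 * Real.pi)))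
    have hd' : ∀ x, HasFDerivAt (Psi f) (-(1 / (2 * Real.pi)) • ∫ y : E2, f y • Kr 0 (x - y)) x := hd
    refine ⟨fun x => (hd' x).differentiableAt, fun x => ?_⟩
    have e : ‖gradient (Psi f) x‖ = ‖fderiv ℝ (Psi f) x‖ := by
      unfold gradient; simp
    rw [e, (hd' x).fderiv, norm_smul]
    have hpi : ‖-(1 / (2 * Real.pi))‖ ≤ 1 := by
      rw [norm_neg, Real.norm_of_nonneg (by positivity), div_le_one (by positivity)]
      linarith [Real.pi_gt_three]
    have h2 : ‖∫ y : E2, f y • Kr 0 (x - y)‖ ≤ ∫ y : E2, |f y| * (1 / ‖x - y‖) := by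
      refine (norm_integral_le_integral_norm _).trans_eq ?_
      congr 1; funext y
      rw [norm_smul, Kr0_norm, Real.norm_eq_abs]
    have hI : Integrable (fun y : E2 => |f y| * (1 / ‖x - y‖)) := by
      refine (Kr0f_int f hf h1 x).norm.congr (.of_forall fun y => ?_)
      simp only
      rw [norm_smul, Kr0_norm, Real.norm_eq_abs]
    rw [← ofReal_integral_eq_lintegral_ofReal hI (.of_forall fun y => by positivity)]
    apply ENNReal.ofReal_le_ofReal
    calc _ ≤ 1 * ‖∫ y : E2, f y • Kr 0 (x - y)‖ := by gcongr
      _ ≤ _ := by rw [one_mul]; exact h2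
  · push Not at hex
    have e : Psi f = fun _ => 0 := by
      funext x
      unfold Psi
      rw [integral_undef (hex x), mul_zero]
    rw [e]
    refine ⟨differentiable_const _, fun x => ?_⟩
    simp [gradient_fun_const']
/-- sub-coercivity estimate for `∫ U |∇(f/U − Ψ_f)|²`. -/
theorem stmt4 :
    ∃ C : ℝ, 0 < C ∧
      ∀ f : E2 → ℝ, Differentiable ℝ f →
        Integrable (fun y : E2 => (1 + ‖y‖ ^ 2) * (f y) ^ 2) →
        Integrable (fun y : E2 => ‖gradient f y‖ ^ 2 / U2 y) →
        (∫ y : E2, U2 y * ‖gradient (fun z => f z / U2 z - Psi f z) y‖ ^ 2)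
          ≥ (1 / C) * (∫ y : E2, ‖gradient f y‖ ^ 2 / U2 y)
            - C * ∫ y : E2, (1 + ‖y‖) * (f y) ^ 2 := by
  obtain ⟨K, hK0, hK⟩ := partB
  refine ⟨K + 2, by linarith, fun f hf h1 h2 => ?_⟩
  obtain ⟨hA1, hA2⟩ := partA f hf h1 h2
  obtain ⟨hC1, hC2⟩ := partC f hf.continuous
  have hS : Integrable (fun y : E2 => (1 + ‖y‖) * f y ^ 2) := by
    have := sq_integrable f hf h1 (fun y => 1 + ‖y‖) 2 (by fun_prop) (fun y => by
      rw [abs_of_nonneg (by positivity)]; nlinarith [sq_nonneg (‖y‖ - 1)])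
    exact this.congr (.of_forall fun y => mul_comm _ _)
  obtain ⟨hB1, hB2⟩ := hK f (gradient (Psi f)) hf.continuous.measurable (measurable_grad _) hS hC2
  have hfs : ∫ y : E2, f y ^ 2 ≤ ∫ y : E2, (1 + ‖y‖) * f y ^ 2 :=
    integral_mono (f2_integrable f hf h1) hS fun y => by
      have := norm_nonneg y
      have := sq_nonneg (f y)
      simp only
      nlinarith
  have hG : ∀ y, gradient (fun z => f z / U2 z - Psi f z) y =
      gradient (fun z => f z / U2 z) y - gradient (Psi f) y := by
    intro y
    have a := (hasGradientAt_div f hf y).differentiableAt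
    unfold gradient
    rw [← map_sub]
    congr 1
    exact fderiv_sub a (hC1 y)
  simp only [hG]
  have hU := U2_cont.measurable
  have hnn : ∀ y, ‖gradient (fun z => f z / U2 z) y - gradient (Psi f) y‖ ^ 2 ≤
      2 * ‖gradient (fun z => f z / U2 z) y‖ ^ 2 + 2 * ‖gradient (Psi f) y‖ ^ 2 := fun y => by
    have := norm_sub_le (gradient (fun z => f z / U2 z) y) (gradient (Psi f) y)
    have h0 := norm_nonneg (gradient (fun z => f z / U2 z) y - gradient (Psi f) y)
    nlinarith [sq_nonneg (‖gradient (fun z => f z / U2 z) y‖ - ‖gradient (Psi f) y‖)]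
  have hnn2 : ∀ y, ‖gradient (fun z => f z / U2 z) y‖ ^ 2 ≤ 2 * ‖gradient (fun z => f z / U2 z) y - gradient (Psi f) y‖ ^ 2
       + 2 * ‖gradient (Psi f) y‖ ^ 2 := fun y => by
    have := norm_le_norm_sub_add (gradient (fun z => f z / U2 z) y) (gradient (Psi f) y)
    have h0 := norm_nonneg (gradient (fun z => f z / U2 z) y)
    nlinarith [sq_nonneg (‖gradient (fun z => f z / U2 z) y - gradient (Psi f) y‖ - ‖gradient (Psi f) y‖)]
  have hI : Integrable (fun y => U2 y * ‖gradient (fun z => f z / U2 z) y - gradient (Psi f) y‖ ^ 2) := by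
    refine ((hA1.const_mul 2).add (hB1.const_mul 2)).mono' ?_ (.of_forall fun y => ?_)
    · have := measurable_grad (Psi f)
      have := measurable_grad (fun z => f z / U2 z)
      exact (by fun_prop : Measurable _).aestronglyMeasurable
    · rw [Real.norm_of_nonneg (mul_nonneg (U2_pos y).le (by positivity))]
      simp only [Pi.add_apply]
      nlinarith [hnn y, U2_pos y]
  have hfin := integral_mono hA1 ((hI.const_mul 2).add (hB1.const_mul 2)) (fun y => by
    simp only [Pi.add_apply]
    nlinarith [hnn2 y, U2_pos y])
  rw [integral_add' (hI.const_mul 2) (hB1.const_mul 2), integral_const_mul, integral_const_mul] at hfin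
  have hGn : 0 ≤ ∫ y : E2, ‖gradient f y‖ ^ 2 / U2 y :=
    integral_nonneg fun y => div_nonneg (by positivity) (U2_pos y).le
  have hSn : 0 ≤ ∫ y : E2, (1 + ‖y‖) * f y ^ 2 := integral_nonneg fun y => by positivity
  have hc : 1 / (K + 2) * (∫ y : E2, ‖gradient f y‖ ^ 2 / U2 y) ≤ 1 / 2 * (∫ y : E2, ‖gradient f y‖ ^ 2 / U2 y) := by
    apply mul_le_mul_of_nonneg_right _ hGn
    exact one_div_le_one_div_of_le (by norm_num) (by linarith)
  nlinarith
end
end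

section
/- There exists a constant C > 0 such that for every ν > 0 and every weakly differentiable f : ℝ² → ℝ with ∫_{ℝ²} f²/U_ν < ∞ and ∫_{ℝ²} |∇f|²/U_ν < ∞, one has ∫_{ℝ²} U_ν |∇(f/U_ν − Ψ_f)|² ≤ C ∫_{ℝ²} |∇f|²/U_ν. -/
open MeasureTheory
open scoped RealInnerProductSpace

noncomputable section

lemma aux_K0 : ∃ K : ℝ, 0 < K ∧ ∀ ν : ℝ, 0 < ν →
    Integrable (fun z : E2 => ‖z‖⁻¹ / (ν ^ 2 + ‖z‖ ^ 2)) ∧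
    ∫⁻ z : E2, ENNReal.ofReal (‖z‖⁻¹ / (ν ^ 2 + ‖z‖ ^ 2)) ≤ ENNReal.ofReal (K / ν) := by
  refine ⟨2 * volume.real (Metric.ball (0 : E2) 1) * Real.pi + 1, by positivity, ?_⟩
  intro ν hν
  have e1 : ∀ y : ℝ, (ν ^ 2 + y ^ 2)⁻¹ = (ν ^ 2)⁻¹ * (1 + (y / ν) ^ 2)⁻¹ := by
    intro y
    have : 0 < ν ^ 2 + y ^ 2 := by positivity
    field_simp
  have i1 : Integrable (fun y : ℝ => (ν ^ 2 + y ^ 2)⁻¹) := by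
    simp_rw [e1]
    exact (integrable_inv_one_add_sq.comp_div hν.ne').const_mul _
  have v1 : ∫ y : ℝ, (ν ^ 2 + y ^ 2)⁻¹ = Real.pi / ν := by
    simp_rw [e1]
    rw [integral_const_mul, Measure.integral_comp_div (fun y : ℝ => (1 + y ^ 2)⁻¹) ν,
      integral_univ_inv_one_add_sq, abs_of_pos hν, smul_eq_mul]
    field_simp
  have hd : Module.finrank ℝ E2 = 2 := by simp [E2]
  have e2 : ∀ y ∈ Set.Ioi (0 : ℝ), y ^ (Module.finrank ℝ E2 - 1) • (y⁻¹ / (ν ^ 2 + y ^ 2))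
      = (ν ^ 2 + y ^ 2)⁻¹ := by
    intro y hy
    have hy : 0 < y := hy
    rw [hd, smul_eq_mul]
    simp
    field_simp
  have hI : Integrable (fun z : E2 => ‖z‖⁻¹ / (ν ^ 2 + ‖z‖ ^ 2)) := by
    rw [integrable_fun_norm_addHaar volume (f := fun r : ℝ => r⁻¹ / (ν ^ 2 + r ^ 2))]
    exact (i1.integrableOn).congr_fun (fun y hy => (e2 y hy).symm) measurableSet_Ioi
  refine ⟨hI, ?_⟩
  rw [← ofReal_integral_eq_lintegral_ofReal hI (Filter.Eventually.of_forall fun z => by positivity)]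
  apply ENNReal.ofReal_le_ofReal
  rw [integral_fun_norm_addHaar volume (fun r : ℝ => r⁻¹ / (ν ^ 2 + r ^ 2)),
    setIntegral_congr_fun measurableSet_Ioi e2, hd]
  have h3 : ∫ y in Set.Ioi (0 : ℝ), (ν ^ 2 + y ^ 2)⁻¹ ≤ Real.pi / ν := by
    rw [← v1]
    exact setIntegral_le_integral i1 (Filter.Eventually.of_forall fun z => by positivity)
  have hb : 0 ≤ volume.real (Metric.ball (0 : E2) 1) := by positivity
  simp only [nsmul_eq_mul, smul_eq_mul, Nat.cast_ofNat]
  calc _ ≤ 2 * (volume.real (Metric.ball (0 : E2) 1) * (Real.pi / ν)) := by gcongr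
    _ ≤ _ := by
      rw [add_div]
      have : 0 < 1 / ν := by positivity
      have : 2 * (volume.real (Metric.ball (0 : E2) 1) * (Real.pi / ν)) =
        2 * volume.real (Metric.ball (0 : E2) 1) * Real.pi / ν := by ring
      linarith

lemma aux_K1 : ∃ K : ℝ, 0 < K ∧ ∀ ν : ℝ, 0 < ν → ∀ x : E2,
    ∫⁻ y : E2, ENNReal.ofReal (‖x - y‖⁻¹ / (ν ^ 2 + ‖y‖ ^ 2)) ≤ ENNReal.ofReal (K / ν) := by
  obtain ⟨K, hK, h⟩ := aux_K0
  refine ⟨2 * K, by positivity, fun ν hν x => ?_⟩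
  obtain ⟨-, h⟩ := h ν hν
  have hae : ∀ᵐ y : E2, y ≠ 0 := by
    simp [ae_iff]
  calc ∫⁻ y : E2, ENNReal.ofReal (‖x - y‖⁻¹ / (ν ^ 2 + ‖y‖ ^ 2))
      ≤ ∫⁻ y : E2, (ENNReal.ofReal (‖y‖⁻¹ / (ν ^ 2 + ‖y‖ ^ 2)) +
        ENNReal.ofReal (‖x - y‖⁻¹ / (ν ^ 2 + ‖x - y‖ ^ 2))) := by
        apply lintegral_mono_ae
        filter_upwards [hae] with y hy
        have hy' : 0 < ‖y‖ := norm_pos_iff.2 hy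
        rcases le_total ‖x - y‖ ‖y‖ with h | h
        · refine le_trans (ENNReal.ofReal_le_ofReal ?_) le_add_self
          gcongr
        · refine le_trans (ENNReal.ofReal_le_ofReal ?_) le_self_add
          gcongr
    _ = (∫⁻ y : E2, ENNReal.ofReal (‖y‖⁻¹ / (ν ^ 2 + ‖y‖ ^ 2))) +
        ∫⁻ y : E2, ENNReal.ofReal (‖y‖⁻¹ / (ν ^ 2 + ‖y‖ ^ 2)) := by
        rw [lintegral_add_left (by fun_prop)]
        congr 1
        exact lintegral_sub_left_eq_self
          (fun y : E2 => ENNReal.ofReal (‖y‖⁻¹ / (ν ^ 2 + ‖y‖ ^ 2))) x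
    _ ≤ ENNReal.ofReal (K / ν) + ENNReal.ofReal (K / ν) := add_le_add h h
    _ = _ := by
        rw [← ENNReal.ofReal_add (by positivity) (by positivity)]
        congr 1; ring

/-- potential of absolute value -/
def FF (f : E2 → ℝ) (x : E2) : ENNReal := ∫⁻ y : E2, ENNReal.ofReal (‖x - y‖⁻¹ * |f y|)

lemma aux_CS {g h : E2 → ℝ} (hg : Measurable g) (hh : Measurable h) (hg0 : ∀ y, 0 ≤ g y)
    (hh0 : ∀ y, 0 ≤ h y) :
    (∫⁻ y : E2, ENNReal.ofReal (Real.sqrt (g y) * Real.sqrt (h y))) ^ 2 ≤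
      (∫⁻ y : E2, ENNReal.ofReal (g y)) * ∫⁻ y : E2, ENNReal.ofReal (h y) := by
  have := ENNReal.lintegral_mul_le_Lp_mul_Lq (volume : Measure E2) Real.HolderConjugate.two_two
    (f := fun y => ENNReal.ofReal (Real.sqrt (g y))) (g := fun y => ENNReal.ofReal (Real.sqrt (h y)))
    (by fun_prop) (by fun_prop)
  have hsq : ∀ t : ℝ, 0 ≤ t → ENNReal.ofReal (Real.sqrt t) ^ (2 : ℝ) = ENNReal.ofReal t := by
    intro t ht
    rw [ENNReal.rpow_two, ← ENNReal.ofReal_pow (by positivity), Real.sq_sqrt ht]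
  simp only [Pi.mul_apply, hsq _ (hg0 _), hsq _ (hh0 _)] at this
  simp_rw [ENNReal.ofReal_mul (Real.sqrt_nonneg _)]
  calc _ ≤ _ := pow_le_pow_left' this 2
    _ = _ := by
      rw [mul_pow, ← ENNReal.rpow_two, ← ENNReal.rpow_two, ← ENNReal.rpow_mul, ← ENNReal.rpow_mul]
      norm_num

lemma aux_P {K ν : ℝ} (hν : 0 < ν)
    (hK : ∀ x : E2, ∫⁻ y : E2, ENNReal.ofReal (‖x - y‖⁻¹ / (ν ^ 2 + ‖y‖ ^ 2))
      ≤ ENNReal.ofReal (K / ν)) {f : E2 → ℝ} (hf : Measurable f) (h : E2) :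
    ∫⁻ x : E2, ENNReal.ofReal (1 / (ν ^ 2 + ‖x‖ ^ 2)) * FF f (x + h) ^ 2 ≤
      ENNReal.ofReal (K / ν) ^ 2 * ∫⁻ y : E2, ENNReal.ofReal ((ν ^ 2 + ‖y‖ ^ 2) * f y ^ 2) := by
  have h1 : ∀ x : E2, FF f x ^ 2 ≤ ENNReal.ofReal (K / ν) *
      ∫⁻ y : E2, ENNReal.ofReal (‖x - y‖⁻¹ * ((ν ^ 2 + ‖y‖ ^ 2) * f y ^ 2)) := by
    intro x
    have := aux_CS (g := fun y => ‖x - y‖⁻¹ / (ν ^ 2 + ‖y‖ ^ 2))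
      (h := fun y => ‖x - y‖⁻¹ * ((ν ^ 2 + ‖y‖ ^ 2) * f y ^ 2)) (by fun_prop) (by fun_prop)
      (fun y => by positivity) (fun y => by positivity)
    refine le_trans (le_of_eq ?_) (this.trans (mul_le_mul_left (hK x) _))
    unfold FF
    congr 2
    ext y
    congr 1
    rw [← Real.sqrt_mul (by positivity)]
    have : ‖x - y‖⁻¹ / (ν ^ 2 + ‖y‖ ^ 2) * (‖x - y‖⁻¹ * ((ν ^ 2 + ‖y‖ ^ 2) * f y ^ 2))
      = (‖x - y‖⁻¹ * |f y|) ^ 2 := by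
      rw [mul_pow, sq_abs]
      have : 0 < ν ^ 2 + ‖y‖ ^ 2 := by positivity
      field_simp
    rw [this, Real.sqrt_sq (by positivity)]
  calc ∫⁻ x : E2, ENNReal.ofReal (1 / (ν ^ 2 + ‖x‖ ^ 2)) * FF f (x + h) ^ 2
      ≤ ∫⁻ x : E2, ENNReal.ofReal (K / ν) * ∫⁻ y : E2, ENNReal.ofReal (1 / (ν ^ 2 + ‖x‖ ^ 2)) *
        ENNReal.ofReal (‖x + h - y‖⁻¹ * ((ν ^ 2 + ‖y‖ ^ 2) * f y ^ 2)) := by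
        apply lintegral_mono
        intro x
        simp only
        rw [lintegral_const_mul _ (by fun_prop), mul_left_comm]
        gcongr
        exact h1 _
    _ = ENNReal.ofReal (K / ν) * ∫⁻ x : E2, ∫⁻ y : E2,
          ENNReal.ofReal ((ν ^ 2 + ‖y‖ ^ 2) * f y ^ 2) *
          ENNReal.ofReal (‖(y - h) - x‖⁻¹ / (ν ^ 2 + ‖x‖ ^ 2)) := by
        rw [lintegral_const_mul' _ _ ENNReal.ofReal_ne_top]
        congr 1
        refine lintegral_congr fun x => lintegral_congr fun y => ?_
        rw [← ENNReal.ofReal_mul (by positivity), ← ENNReal.ofReal_mul (by positivity)]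
        congr 1
        have : ‖x + h - y‖ = ‖y - h - x‖ := by rw [← norm_neg]; congr 1; abel
        rw [this]; ring
    _ = ENNReal.ofReal (K / ν) * ∫⁻ y : E2, ENNReal.ofReal ((ν ^ 2 + ‖y‖ ^ 2) * f y ^ 2) *
          ∫⁻ x : E2, ENNReal.ofReal (‖(y - h) - x‖⁻¹ / (ν ^ 2 + ‖x‖ ^ 2)) := by
        rw [lintegral_lintegral_swap]
        · congr 1
          refine lintegral_congr fun y => ?_
          rw [lintegral_const_mul _ (by fun_prop)]
        · apply Measurable.aemeasurable
          simp only [Function.uncurry_def]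
          fun_prop
    _ ≤ ENNReal.ofReal (K / ν) * ∫⁻ y : E2, ENNReal.ofReal ((ν ^ 2 + ‖y‖ ^ 2) * f y ^ 2) *
          ENNReal.ofReal (K / ν) := by
        gcongr
        exact hK _
    _ = _ := by
        rw [lintegral_mul_const _ (by fun_prop)]; ring
lemma aux_logsq {t : ℝ} (ht : 0 ≤ t) : Real.log t ^ 2 ≤ 4 * (t + t⁻¹) := by
  rcases ht.eq_or_lt with rfl | ht
  · simp
  have key : ∀ s : ℝ, 1 ≤ s → Real.log s ^ 2 ≤ 4 * s := by
    intro s hs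
    have h0 : 0 ≤ Real.log s := Real.log_nonneg hs
    have h1 : Real.log s ≤ 2 * Real.sqrt s := by
      have := Real.log_le_self (Real.sqrt_nonneg s)
      rw [Real.log_sqrt (by linarith)] at this
      linarith
    calc Real.log s ^ 2 ≤ (2 * Real.sqrt s) ^ 2 := by gcongr
      _ = 4 * s := by rw [mul_pow, Real.sq_sqrt (by linarith)]; norm_num
  have hi : 0 < t⁻¹ := by positivity
  rcases le_total 1 t with h | h
  · have := key t h; linarith
  · have := key t⁻¹ ((one_le_inv₀ ht).2 h)
    rw [Real.log_inv, neg_sq] at this; linarith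

lemma aux_logint {ν : ℝ} (hν : 0 < ν)
    (hk : Integrable (fun z : E2 => ‖z‖⁻¹ / (ν ^ 2 + ‖z‖ ^ 2))) (x : E2)
    (hK : ∫⁻ y : E2, ENNReal.ofReal (‖x - y‖⁻¹ / (ν ^ 2 + ‖y‖ ^ 2)) < ⊤) {f : E2 → ℝ}
    (hf : Measurable f) (hf2 : Integrable (fun y : E2 => (ν ^ 2 + ‖y‖ ^ 2) ^ 2 * f y ^ 2)) :
    Integrable (fun y : E2 => Real.log ‖x - y‖ * f y) := by
  have hkx : Integrable (fun y : E2 => ‖x - y‖⁻¹ / (ν ^ 2 + ‖y‖ ^ 2)) := by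
    refine ⟨Measurable.aestronglyMeasurable (by fun_prop), ?_⟩
    rw [hasFiniteIntegral_iff_ofReal (Filter.Eventually.of_forall fun y => by positivity)]
    exact hK
  have hB := (((hk.const_mul (‖x‖ / (2 * ν) + 1)).add (hkx.const_mul (ν ^ 2)⁻¹)).const_mul 4).add hf2
  refine hB.mono' (Measurable.aestronglyMeasurable (by fun_prop)) ?_
  have hae : ∀ᵐ y : E2, y ≠ 0 := by
    simp [ae_iff]
  filter_upwards [hae] with y hy
  have hy' : 0 < ‖y‖ := norm_pos_iff.2 hy
  simp only [Pi.add_apply, Real.norm_eq_abs]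
  set w := ν ^ 2 + ‖y‖ ^ 2 with hw
  have hwp : 0 < w := by positivity
  have hwν : ν ^ 2 ≤ w := by rw [hw]; nlinarith [sq_nonneg ‖y‖]
  have hwy : ‖y‖ ^ 2 ≤ w := by rw [hw]; nlinarith [sq_nonneg ν]
  have hwm : 2 * ν * ‖y‖ ≤ w := by rw [hw]; nlinarith [sq_nonneg (ν - ‖y‖)]
  have hlog := aux_logsq (norm_nonneg (x - y))
  have htri : ‖x - y‖ ≤ ‖x‖ + ‖y‖ := norm_sub_le x y
  have ham : |Real.log ‖x - y‖ * f y| ≤ Real.log ‖x - y‖ ^ 2 / w ^ 2 + w ^ 2 * f y ^ 2 := by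
    have e : Real.log ‖x - y‖ * f y = (Real.log ‖x - y‖ / w) * (w * f y) := by field_simp
    rw [e, abs_le, ← div_pow, ← mul_pow]
    constructor <;> nlinarith [sq_nonneg (Real.log ‖x - y‖ / w + w * f y),
      sq_nonneg (Real.log ‖x - y‖ / w - w * f y), sq_nonneg (Real.log ‖x - y‖ / w), sq_nonneg (w * f y)]
  have h1 : ‖y‖ / w ^ 2 ≤ ‖y‖⁻¹ / w := by
    rw [div_le_div_iff₀ (by positivity) hwp]
    have : ‖y‖⁻¹ * w ^ 2 = ‖y‖⁻¹ * w * w := by ring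
    rw [this]
    gcongr
    rw [inv_mul_eq_div, le_div_iff₀ hy']
    nlinarith
  have h2 : 1 / w ^ 2 ≤ (1 / (2 * ν)) * (‖y‖⁻¹ / w) := by
    have : (1 / (2 * ν)) * (‖y‖⁻¹ / w) = 1 / ((2 * ν * ‖y‖) * w) := by field_simp
    rw [this, sq]
    gcongr
  have h3 : ‖x - y‖⁻¹ / w ^ 2 ≤ (ν ^ 2)⁻¹ * (‖x - y‖⁻¹ / w) := by
    have : (ν ^ 2)⁻¹ * (‖x - y‖⁻¹ / w) = ‖x - y‖⁻¹ / (ν ^ 2 * w) := by field_simp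
    rw [this, sq w]
    gcongr
  calc _ ≤ _ := ham
    _ ≤ 4 * (‖x‖ + ‖y‖ + ‖x - y‖⁻¹) / w ^ 2 + w ^ 2 * f y ^ 2 := by
      gcongr; linarith
    _ = 4 * (‖x‖ * (1 / w ^ 2) + ‖y‖ / w ^ 2 + ‖x - y‖⁻¹ / w ^ 2) + w ^ 2 * f y ^ 2 := by ring
    _ ≤ 4 * (‖x‖ * ((1 / (2 * ν)) * (‖y‖⁻¹ / w)) + ‖y‖⁻¹ / w + (ν ^ 2)⁻¹ * (‖x - y‖⁻¹ / w))
        + w ^ 2 * f y ^ 2 := by gcongr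
    _ = _ := by ring

lemma aux_logdiff {a b c : ℝ} (ha : 0 < a) (hb : 0 < b) (h : |a - b| ≤ c) :
    |Real.log a - Real.log b| ≤ c * (a⁻¹ + b⁻¹) := by
  have hc : 0 ≤ c := (abs_nonneg _).trans h
  have h1 : ∀ a b : ℝ, 0 < a → 0 < b → |a - b| ≤ c → Real.log a - Real.log b ≤ c * b⁻¹ := by
    intro a b ha hb h
    rw [← Real.log_div ha.ne' hb.ne']
    have := Real.log_le_sub_one_of_pos (div_pos ha hb)
    have e : a / b - 1 = (a - b) * b⁻¹ := by field_simp
    rw [e] at this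
    refine this.trans ?_
    gcongr
    exact (le_abs_self _).trans h
  have i1 := h1 a b ha hb h
  have i2 := h1 b a hb ha (by rwa [abs_sub_comm])
  have : 0 ≤ c * a⁻¹ := by positivity
  have : 0 ≤ c * b⁻¹ := by positivity
  rw [abs_le]; constructor <;> nlinarith

lemma aux_psidiff {f : E2 → ℝ} (hf : Measurable f)
    (hint : ∀ x : E2, Integrable (fun y : E2 => Real.log ‖x - y‖ * f y)) (x h : E2) :
    ENNReal.ofReal |Psi f (x + h) - Psi f x| ≤ ENNReal.ofReal ‖h‖ * (FF f (x + h) + FF f x) := by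
  unfold Psi
  rw [← mul_sub, ← integral_sub (hint _) (hint _), abs_mul]
  have hc : |-(1 / (2 * Real.pi))| ≤ 1 := by
    rw [abs_neg, abs_of_pos (by positivity), div_le_one (by positivity)]
    linarith [Real.pi_gt_three]
  have hae : ∀ z : E2, ∀ᵐ y : E2, y ≠ z := fun z => by simp [ae_iff]
  calc _ ≤ ENNReal.ofReal |∫ y : E2, (Real.log ‖x + h - y‖ * f y - Real.log ‖x - y‖ * f y)| := by
        apply ENNReal.ofReal_le_ofReal
        exact mul_le_of_le_one_left (abs_nonneg _) hc
    _ ≤ ∫⁻ y : E2, ENNReal.ofReal |Real.log ‖x + h - y‖ * f y - Real.log ‖x - y‖ * f y| := by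
        rw [← Real.enorm_eq_ofReal_abs]
        simp_rw [← Real.enorm_eq_ofReal_abs]
        exact enorm_integral_le_lintegral_enorm _
    _ ≤ ∫⁻ y : E2, ENNReal.ofReal ‖h‖ * (ENNReal.ofReal (‖x + h - y‖⁻¹ * |f y|) +
          ENNReal.ofReal (‖x - y‖⁻¹ * |f y|)) := by
        apply lintegral_mono_ae
        filter_upwards [hae x, hae (x + h)] with y h1 h2
        rw [← ENNReal.ofReal_add (by positivity) (by positivity),
          ← ENNReal.ofReal_mul (by positivity)]
        apply ENNReal.ofReal_le_ofReal
        rw [← sub_mul, abs_mul]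
        have := aux_logdiff (a := ‖x + h - y‖) (b := ‖x - y‖) (c := ‖h‖)
          (norm_pos_iff.2 (sub_ne_zero.2 h2.symm)) (norm_pos_iff.2 (sub_ne_zero.2 h1.symm)) (by
            refine (abs_norm_sub_norm_le _ _).trans (le_of_eq ?_)
            congr 1; abel)
        calc _ ≤ _ := mul_le_mul_of_nonneg_right this (abs_nonneg (f y))
          _ = _ := by ring
    _ = _ := by
        rw [lintegral_const_mul _ (by fun_prop), lintegral_add_left (by fun_prop)]
        rfl

lemma aux_sq (a b : ENNReal) : (a + b) ^ 2 ≤ 4 * (a ^ 2 + b ^ 2) := by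
  have key : ∀ a b : ENNReal, a ≤ b → (a + b) ^ 2 ≤ 4 * (a ^ 2 + b ^ 2) := by
    intro a b h
    calc (a + b) ^ 2 ≤ (b + b) ^ 2 := by gcongr
      _ = 4 * b ^ 2 := by ring
      _ ≤ _ := by gcongr; exact le_add_self
  rcases le_total a b with h | h
  · exact key a b h
  · rw [add_comm a b, add_comm (a ^ 2)]; exact key b a h

lemma aux_dpsi {f : E2 → ℝ} (hf : Measurable f)
    (hint : ∀ x : E2, Integrable (fun y : E2 => Real.log ‖x - y‖ * f y)) (x v : E2) (hv : ‖v‖ = 1)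
    (hd : DifferentiableAt ℝ (Psi f) x) :
    ENNReal.ofReal ((fderiv ℝ (Psi f) x v) ^ 2) ≤ Filter.liminf (fun n : ℕ =>
      4 * (FF f (x + ((n : ℝ) + 1)⁻¹ • v) ^ 2 + FF f x ^ 2)) Filter.atTop := by
  have hlim : Filter.Tendsto (fun n : ℕ => ((n : ℝ) + 1) • (Psi f (x + ((n : ℝ) + 1)⁻¹ • v) - Psi f x))
      Filter.atTop (nhds (fderiv ℝ (Psi f) x v)) := by
    have := hd.hasFDerivAt.lim_real v
    exact this.comp (Filter.tendsto_atTop_add_const_right _ 1 tendsto_natCast_atTop_atTop)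
  have h2 := (ENNReal.continuous_ofReal.tendsto _).comp (hlim.pow 2)
  rw [← h2.liminf_eq]
  refine Filter.liminf_le_liminf ?_
  · refine Filter.Eventually.of_forall fun n => ?_
    simp only [Function.comp, smul_eq_mul]
    refine le_trans ?_ (aux_sq _ _)
    have hp : (0 : ℝ) < (n : ℝ) + 1 := by positivity
    have := aux_psidiff hf hint x (((n : ℝ) + 1)⁻¹ • v)
    rw [norm_smul, hv, mul_one, Real.norm_of_nonneg (by positivity)] at this
    rw [← sq_abs, ENNReal.ofReal_pow (abs_nonneg _)]
    gcongr
    rw [abs_mul, abs_of_pos hp, ENNReal.ofReal_mul hp.le]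
    calc _ ≤ _ := mul_le_mul_right this _
      _ = _ := by
        rw [← mul_assoc, ← ENNReal.ofReal_mul hp.le, mul_inv_cancel₀ hp.ne', ENNReal.ofReal_one, one_mul]

lemma aux_FFmeas {f : E2 → ℝ} (hf : Measurable f) : Measurable (FF f) := by
  unfold FF
  apply Measurable.lintegral_prod_right' (f := fun p : E2 × E2 =>
    ENNReal.ofReal (‖p.1 - p.2‖⁻¹ * |f p.2|))
  fun_prop
lemma aux_intzero {X : E2 → ℝ} {v : E2} (hX : Differentiable ℝ X) (h1 : Integrable X)
    (h2 : Integrable (fun y => fderiv ℝ X y v)) : ∫ y, fderiv ℝ X y v = 0 := by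
  have := integral_mul_fderiv_eq_neg_fderiv_mul_of_integrable (μ := (volume : Measure E2))
    (f := X) (g := fun _ : E2 => (1 : ℝ)) (v := v)
    (by simpa using h2) (by simp) (by simpa using h1) (fun x _ => hX x) (fun x _ => by fun_prop)
  simpa using this.symm

lemma aux_grad (f : E2 → ℝ) (y v : E2) : fderiv ℝ f y v = ⟪gradient f y, v⟫ := by
  simp [gradient]

lemma aux_gradi (f : E2 → ℝ) (y : E2) (i : Fin 2) :
    fderiv ℝ f y (EuclideanSpace.single i 1) = gradient f y i := by
  rw [aux_grad, EuclideanSpace.inner_single_right]; simp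

lemma aux_nsq (y : E2) : ‖y‖ ^ 2 = y 0 ^ 2 + y 1 ^ 2 := by
  rw [EuclideanSpace.norm_sq_eq]; simp

lemma aux_dX (ν : ℝ) {f : E2 → ℝ} (hf : Differentiable ℝ f) (i : Fin 2) (y : E2) :
    HasFDerivAt (fun y : E2 => (ν ^ 2 + ‖y‖ ^ 2) * f y ^ 2 * y i)
      (((ν ^ 2 + ‖y‖ ^ 2) * f y ^ 2) • (EuclideanSpace.proj i : E2 →L[ℝ] ℝ) +
       y i • ((ν ^ 2 + ‖y‖ ^ 2) • ((2 * f y) • fderiv ℝ f y) +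
        f y ^ 2 • ((2 : ℝ) • innerSL ℝ y))) y := by
  have h1 : HasFDerivAt (fun y : E2 => ν ^ 2 + ‖y‖ ^ 2) ((2 : ℝ) • innerSL ℝ y) y := by
    have := (hasStrictFDerivAt_norm_sq y).hasFDerivAt.const_add (ν ^ 2)
    refine this.congr_fderiv ?_
    ext; simp
  have h2 : HasFDerivAt (fun y : E2 => f y ^ 2) ((2 * f y) • fderiv ℝ f y) y := by
    have := (hf y).hasFDerivAt.pow 2
    refine this.congr_fderiv ?_
    ext; simp
  have h3 : HasFDerivAt (fun y : E2 => y i) (EuclideanSpace.proj i : E2 →L[ℝ] ℝ) y :=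
    (EuclideanSpace.proj i : E2 →L[ℝ] ℝ).hasFDerivAt
  exact (h1.mul h2).mul h3

lemma aux_meas (ν : ℝ) {f G : E2 → ℝ} (hf : Measurable f) (hG : Measurable G) (i : Fin 2) :
    Measurable (fun y : E2 => (ν ^ 2 + ‖y‖ ^ 2) * f y ^ 2 +
      y i * ((ν ^ 2 + ‖y‖ ^ 2) * (2 * f y * G y) + f y ^ 2 * (2 * y i))) := by
  fun_prop

set_option maxHeartbeats 1000000 in
lemma aux_hardy {ν : ℝ} (hν : 0 < ν) {f : E2 → ℝ} (hf : Differentiable ℝ f)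
    (hf2 : Integrable (fun y : E2 => (ν ^ 2 + ‖y‖ ^ 2) ^ 2 * f y ^ 2))
    (hg2 : Integrable (fun y : E2 => (ν ^ 2 + ‖y‖ ^ 2) ^ 2 * ‖gradient f y‖ ^ 2)) :
    Integrable (fun y : E2 => (ν ^ 2 + ‖y‖ ^ 2) * f y ^ 2) ∧
    ∫ y : E2, (ν ^ 2 + ‖y‖ ^ 2) * f y ^ 2 ≤
      ∫ y : E2, (ν ^ 2 + ‖y‖ ^ 2) ^ 2 * ‖gradient f y‖ ^ 2 := by
  have hfm : Measurable f := hf.continuous.measurable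
  have hw : ∀ y : E2, 0 < ν ^ 2 + ‖y‖ ^ 2 := fun y => by positivity
  have hwν : ∀ y : E2, ν ^ 2 ≤ ν ^ 2 + ‖y‖ ^ 2 := fun y => by nlinarith [sq_nonneg ‖y‖]
  have hyi : ∀ (y : E2) i, y i ^ 2 ≤ ‖y‖ ^ 2 := fun y i => by
    have := PiLp.norm_apply_le y i
    rw [Real.norm_eq_abs] at this
    rw [← sq_abs]; gcongr
  have hI1 : Integrable (fun y : E2 => (ν ^ 2 + ‖y‖ ^ 2) * f y ^ 2) := by
    refine (hf2.const_mul (ν ^ 2)⁻¹).mono' (Measurable.aestronglyMeasurable (by fun_prop))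
      (Filter.Eventually.of_forall fun y => ?_)
    rw [Real.norm_of_nonneg (by positivity), ← mul_assoc]
    gcongr
    rw [inv_mul_eq_div, le_div_iff₀ (by positivity)]
    nlinarith [hw y, hwν y]
  refine ⟨hI1, ?_⟩
  have hsq : ∀ t w : ℝ, 0 < w → t ^ 2 ≤ w → |t| ≤ ν⁻¹ * w + ν := by
    intro t w hw h
    have h0 : |t| ^ 2 ≤ w := by rwa [sq_abs]
    have h1 : |t| * ν ≤ w + ν ^ 2 := by nlinarith [sq_nonneg (|t| - ν)]
    have e : ν⁻¹ * w + ν = (w + ν ^ 2) / ν := by field_simp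
    rw [e, le_div_iff₀ hν]; exact h1
  have hX : ∀ i : Fin 2, Integrable (fun y : E2 => (ν ^ 2 + ‖y‖ ^ 2) * f y ^ 2 * y i) := by
    intro i
    refine ((hf2.const_mul ν⁻¹).add (hI1.const_mul ν)).mono'
      (Measurable.aestronglyMeasurable (by fun_prop)) (Filter.Eventually.of_forall fun y => ?_)
    rw [norm_mul, Real.norm_of_nonneg (by positivity), Real.norm_eq_abs]
    have := hsq (y i) (ν ^ 2 + ‖y‖ ^ 2) (hw y) (by nlinarith [hyi y i])
    calc _ ≤ (ν ^ 2 + ‖y‖ ^ 2) * f y ^ 2 * (ν⁻¹ * (ν ^ 2 + ‖y‖ ^ 2) + ν) := by gcongr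
      _ = _ := by simp only [Pi.add_apply]; ring
  have hd : ∀ (i : Fin 2) (y : E2),
      fderiv ℝ (fun y : E2 => (ν ^ 2 + ‖y‖ ^ 2) * f y ^ 2 * y i) y (EuclideanSpace.single i 1) =
      (ν ^ 2 + ‖y‖ ^ 2) * f y ^ 2 + y i * ((ν ^ 2 + ‖y‖ ^ 2) * (2 * f y * gradient f y i)
        + f y ^ 2 * (2 * y i)) := by
    intro i y
    rw [(aux_dX ν hf i y).fderiv]
    simp [aux_gradi, EuclideanSpace.inner_single_right]
    ring
  have hgm : ∀ i : Fin 2, Measurable (fun y => gradient f y i) := by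
    intro i
    simp_rw [← aux_gradi]
    exact measurable_fderiv_apply_const ℝ f _
  have hdI : ∀ i : Fin 2, Integrable (fun y : E2 =>
      fderiv ℝ (fun y : E2 => (ν ^ 2 + ‖y‖ ^ 2) * f y ^ 2 * y i) y (EuclideanSpace.single i 1)) := by
    intro i
    simp_rw [hd]
    have hgmi := hgm i
    refine ((hI1.const_mul 4).add hg2).mono'
      (aux_meas ν hfm hgmi i).aestronglyMeasurable (Filter.Eventually.of_forall fun y => ?_)
    have h1 := hyi y i
    have h2 := hyi (gradient f y) i
    simp only [Pi.add_apply, Real.norm_eq_abs]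
    have hwp := hw y
    set w := ν ^ 2 + ‖y‖ ^ 2 with hwd
    have h3 : y i ^ 2 ≤ w := by rw [hwd]; nlinarith [sq_nonneg ν]
    have hm : |2 * (y i * gradient f y i) * f y| ≤ f y ^ 2 + w * ‖gradient f y‖ ^ 2 := by
      have : (y i * gradient f y i) ^ 2 ≤ w * ‖gradient f y‖ ^ 2 := by
        rw [mul_pow]; gcongr
      rw [abs_le]
      constructor <;> nlinarith [sq_nonneg (y i * gradient f y i + f y),
        sq_nonneg (y i * gradient f y i - f y)]
    have e : w * f y ^ 2 + y i * (w * (2 * f y * gradient f y i) + f y ^ 2 * (2 * y i)) =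
      w * f y ^ 2 + w * (2 * (y i * gradient f y i) * f y) + 2 * (y i ^ 2 * f y ^ 2) := by ring
    have h4 : y i ^ 2 * f y ^ 2 ≤ w * f y ^ 2 := by gcongr
    have h5 : 0 ≤ y i ^ 2 * f y ^ 2 := by positivity
    have h6 : 0 ≤ w * f y ^ 2 := by positivity
    rw [e]
    rw [abs_le] at hm ⊢
    have h7 := mul_le_mul_of_nonneg_left hm.1 hwp.le
    have h8 := mul_le_mul_of_nonneg_left hm.2 hwp.le
    constructor <;> nlinarith
  have hz : ∀ i : Fin 2, _ := fun i => aux_intzero (X := fun y : E2 => (ν ^ 2 + ‖y‖ ^ 2) * f y ^ 2 * y i)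
    (v := EuclideanSpace.single i 1) (fun y => (aux_dX ν hf i y).differentiableAt) (hX i) (hdI i)
  have hsum := integral_add (((hdI 0).add (hdI 1))) hg2
  have hsum2 := integral_add (hdI 0) (hdI 1)
  rw [hz 0, hz 1, add_zero] at hsum2
  have hfin : ∫ y : E2, (ν ^ 2 + ‖y‖ ^ 2) * f y ^ 2 ≤ _ :=
    integral_mono hI1 (((hdI 0).add (hdI 1)).add hg2) (by
      intro y
      simp only [Pi.add_apply, hd]
      have hwp := hw y
      have e1 := aux_nsq y
      have e2 := aux_nsq (gradient f y)
      set w := ν ^ 2 + ‖y‖ ^ 2 with hwd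
      set a := y 0
      set b := y 1
      set p := gradient f y 0
      set q := gradient f y 1
      have h0 : 0 ≤ (a ^ 2 + b ^ 2) * f y ^ 2 := by positivity
      have h1 : (a ^ 2 + b ^ 2) ≤ w := by rw [hwd, e1]; nlinarith [sq_nonneg ν]
      have h2 : (a * p + b * q) ^ 2 ≤ (a ^ 2 + b ^ 2) * (p ^ 2 + q ^ 2) := by
        nlinarith [sq_nonneg (a * q - b * p)]
      have h3 : (a ^ 2 + b ^ 2) * (p ^ 2 + q ^ 2) ≤ w * (p ^ 2 + q ^ 2) := by gcongr
      have h4 : 0 ≤ f y ^ 2 + 2 * (f y * (a * p + b * q)) + w * (p ^ 2 + q ^ 2) := by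
        nlinarith [sq_nonneg (f y + (a * p + b * q))]
      have h5 := mul_nonneg hwp.le h4
      rw [e2]
      nlinarith)
  refine hfin.trans (le_of_eq ?_)
  simp only [Pi.add_apply] at hsum hsum2 ⊢
  rw [hsum, hsum2, zero_add]
lemma aux_Unu {ν : ℝ} (hν : 0 < ν) (y : E2) : Unu ν y = 8 * ν ^ 2 / (ν ^ 2 + ‖y‖ ^ 2) ^ 2 := by
  unfold Unu U2
  rw [norm_smul, Real.norm_of_nonneg (by positivity)]
  have : 0 < ν ^ 2 + ‖y‖ ^ 2 := by positivity
  have : 0 < 1 + (1 / ν * ‖y‖) ^ 2 := by positivity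
  field_simp

lemma aux_g1 {ν : ℝ} (hν : 0 < ν) {f : E2 → ℝ} (hf : Differentiable ℝ f) (x : E2) :
    HasGradientAt (fun z => f z / Unu ν z) (((ν ^ 2 + ‖x‖ ^ 2) ^ 2 / (8 * ν ^ 2)) • gradient f x +
      (f x * (ν ^ 2 + ‖x‖ ^ 2) / (2 * ν ^ 2)) • x) x := by
  have e : (fun z => f z / Unu ν z) = fun z => f z * ((ν ^ 2 + ‖z‖ ^ 2) ^ 2 * (8 * ν ^ 2)⁻¹) := by
    ext z
    rw [aux_Unu hν]
    have : 0 < ν ^ 2 + ‖z‖ ^ 2 := by positivity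
    field_simp
  rw [e, hasGradientAt_iff_hasFDerivAt]
  have h1 : HasFDerivAt (fun y : E2 => ν ^ 2 + ‖y‖ ^ 2) ((2 : ℝ) • innerSL ℝ x) x := by
    have := (hasStrictFDerivAt_norm_sq x).hasFDerivAt.const_add (ν ^ 2)
    refine this.congr_fderiv ?_
    ext; simp
  have := (hf x).hasFDerivAt.mul ((h1.pow 2).mul_const (8 * ν ^ 2)⁻¹)
  refine this.congr_fderiv ?_
  ext v
  simp [inner_add_left, real_inner_smul_left]
  field_simp
  ring

lemma aux_point {ν : ℝ} (hν : 0 < ν) {f : E2 → ℝ} (hf : Differentiable ℝ f)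
    (hint : ∀ x : E2, Integrable (fun y : E2 => Real.log ‖x - y‖ * f y)) (x : E2) :
    ENNReal.ofReal (Unu ν x * ‖gradient (fun z => f z / Unu ν z - Psi f z) x‖ ^ 2) ≤
      ENNReal.ofReal (4 * (‖gradient f x‖ ^ 2 / Unu ν x) +
        8 / ν ^ 2 * ((ν ^ 2 + ‖x‖ ^ 2) * f x ^ 2)) +
      (Filter.liminf (fun n : ℕ => ENNReal.ofReal (1 / (ν ^ 2 + ‖x‖ ^ 2)) * (64 *
        (FF f (x + ((n : ℝ) + 1)⁻¹ • EuclideanSpace.single 0 1) ^ 2 + FF f x ^ 2))) Filter.atTop +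
      Filter.liminf (fun n : ℕ => ENNReal.ofReal (1 / (ν ^ 2 + ‖x‖ ^ 2)) * (64 *
        (FF f (x + ((n : ℝ) + 1)⁻¹ • EuclideanSpace.single 1 1) ^ 2 + FF f x ^ 2))) Filter.atTop) := by
  have hg1 := aux_g1 hν hf x
  by_cases hd : DifferentiableAt ℝ (Psi f) x
  swap
  · have hnd : ¬ DifferentiableAt ℝ (fun z => f z / Unu ν z - Psi f z) x := by
      intro h
      apply hd
      have := hg1.differentiableAt.sub h
      simpa [Pi.sub_def] using this
    have : gradient (fun z => f z / Unu ν z - Psi f z) x = 0 := by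
      simp [gradient, fderiv_zero_of_not_differentiableAt hnd]
    rw [this]; simp
  have hgr : gradient (fun z => f z / Unu ν z - Psi f z) x =
      (((ν ^ 2 + ‖x‖ ^ 2) ^ 2 / (8 * ν ^ 2)) • gradient f x +
      (f x * (ν ^ 2 + ‖x‖ ^ 2) / (2 * ν ^ 2)) • x) - gradient (Psi f) x := by
    rw [← hg1.gradient]
    unfold gradient
    rw [fderiv_fun_sub hg1.differentiableAt hd, map_sub]
  have hL : ∀ i : Fin 2, ENNReal.ofReal ((16 / (ν ^ 2 + ‖x‖ ^ 2)) * (gradient (Psi f) x i) ^ 2) ≤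
      Filter.liminf (fun n : ℕ => ENNReal.ofReal (1 / (ν ^ 2 + ‖x‖ ^ 2)) * (64 *
        (FF f (x + ((n : ℝ) + 1)⁻¹ • EuclideanSpace.single i 1) ^ 2 + FF f x ^ 2))) Filter.atTop := by
    intro i
    have h := aux_dpsi hf.continuous.measurable hint x (EuclideanSpace.single i 1) (by simp) hd
    rw [aux_gradi] at h
    rw [ENNReal.ofReal_mul (by positivity)]
    refine (mul_le_mul_right h _).trans ?_
    rw [← ENNReal.liminf_const_mul_of_ne_top ENNReal.ofReal_ne_top]
    refine le_of_eq ?_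
    congr 1
    ext n
    have : (16 / (ν ^ 2 + ‖x‖ ^ 2)) = (1 / (ν ^ 2 + ‖x‖ ^ 2)) * 16 := by ring
    rw [this, ENNReal.ofReal_mul (by positivity), mul_assoc, ← mul_assoc (ENNReal.ofReal 16) 4]
    congr 2
    rw [show (4 : ENNReal) = ENNReal.ofReal 4 by simp, ← ENNReal.ofReal_mul (by norm_num)]
    norm_num
  refine le_trans ?_ (add_le_add le_rfl (add_le_add (hL 0) (hL 1)))
  have hU : 0 < Unu ν x := by rw [aux_Unu hν]; positivity
  rw [← ENNReal.ofReal_add (by positivity) (by positivity),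
    ← ENNReal.ofReal_add (by positivity) (by positivity)]
  apply ENNReal.ofReal_le_ofReal
  rw [← mul_add, ← aux_nsq, hgr, aux_Unu hν]
  have hx2 : ‖x‖ ^ 2 ≤ ν ^ 2 + ‖x‖ ^ 2 := by nlinarith [sq_nonneg ν]
  have hn2 : ν ^ 2 ≤ ν ^ 2 + ‖x‖ ^ 2 := by nlinarith [sq_nonneg ‖x‖]
  have hw : 0 < ν ^ 2 + ‖x‖ ^ 2 := by positivity
  set w := ν ^ 2 + ‖x‖ ^ 2
  have tri : ∀ a b : E2, ‖a + b‖ ^ 2 ≤ 2 * ‖a‖ ^ 2 + 2 * ‖b‖ ^ 2 := by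
    intro a b
    have := norm_add_le a b
    calc _ ≤ (‖a‖ + ‖b‖) ^ 2 := by gcongr
      _ ≤ _ := by nlinarith [sq_nonneg (‖a‖ - ‖b‖)]
  have t1 := tri ((w ^ 2 / (8 * ν ^ 2)) • gradient f x + (f x * w / (2 * ν ^ 2)) • x)
    (- gradient (Psi f) x)
  have t2 := tri ((w ^ 2 / (8 * ν ^ 2)) • gradient f x) ((f x * w / (2 * ν ^ 2)) • x)
  rw [← sub_eq_add_neg, norm_neg] at t1
  rw [norm_smul, norm_smul, mul_pow, mul_pow, Real.norm_eq_abs, Real.norm_eq_abs, sq_abs, sq_abs] at t2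
  calc _ ≤ 8 * ν ^ 2 / w ^ 2 * (2 * (2 * ((w ^ 2 / (8 * ν ^ 2)) ^ 2 * ‖gradient f x‖ ^ 2) +
        2 * ((f x * w / (2 * ν ^ 2)) ^ 2 * ‖x‖ ^ 2)) + 2 * ‖gradient (Psi f) x‖ ^ 2) := by
        gcongr; linarith
    _ = 4 * (‖gradient f x‖ ^ 2 / (8 * ν ^ 2 / w ^ 2)) + 8 / ν ^ 2 * (‖x‖ ^ 2 * f x ^ 2) +
        16 * ν ^ 2 / w ^ 2 * ‖gradient (Psi f) x‖ ^ 2 := by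
        field_simp; ring
    _ ≤ _ := by
        have : 16 * ν ^ 2 / w ^ 2 ≤ 16 / w := by
          rw [div_le_div_iff₀ (by positivity) hw]; nlinarith
        gcongr

/-- boundedness `∫ U_ν |∇(f/U_ν − Ψ_f)|² ≤ C ∫ |∇f|²/U_ν`. -/
theorem stmt5 :
    ∃ C : ℝ, 0 < C ∧
      ∀ ν : ℝ, 0 < ν →
      ∀ f : E2 → ℝ, Differentiable ℝ f →
        Integrable (fun y : E2 => (f y) ^ 2 / Unu ν y) →
        Integrable (fun y : E2 => ‖gradient f y‖ ^ 2 / Unu ν y) →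
        (∫ y : E2, Unu ν y * ‖gradient (fun z => f z / Unu ν z - Psi f z) y‖ ^ 2)
          ≤ C * ∫ y : E2, ‖gradient f y‖ ^ 2 / Unu ν y := by
  obtain ⟨K0, hK0, hk0⟩ := aux_K0
  obtain ⟨K, hK, hk⟩ := aux_K1
  refine ⟨68 + 2048 * K ^ 2, by positivity, ?_⟩
  intro ν hν f hf hf2 hg2
  have hfm : Measurable f := hf.continuous.measurable
  have hUp : ∀ x : E2, 0 < Unu ν x := fun x => by rw [aux_Unu hν]; positivity
  have conv : ∀ (t : ℝ) (y : E2), (ν ^ 2 + ‖y‖ ^ 2) ^ 2 * t = 8 * ν ^ 2 * (t / Unu ν y) := by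
    intro t y
    rw [aux_Unu hν]
    have : 0 < ν ^ 2 + ‖y‖ ^ 2 := by positivity
    field_simp
  have hf2' : Integrable (fun y : E2 => (ν ^ 2 + ‖y‖ ^ 2) ^ 2 * f y ^ 2) := by
    simp_rw [conv]; exact hf2.const_mul _
  have hg2' : Integrable (fun y : E2 => (ν ^ 2 + ‖y‖ ^ 2) ^ 2 * ‖gradient f y‖ ^ 2) := by
    simp_rw [conv]; exact hg2.const_mul _
  obtain ⟨hI, hH⟩ := aux_hardy hν hf hf2' hg2'
  simp_rw [conv] at hH
  rw [integral_const_mul] at hH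
  set D := ∫ y : E2, ‖gradient f y‖ ^ 2 / Unu ν y with hD
  have hD0 : 0 ≤ D := integral_nonneg fun y => div_nonneg (by positivity) (hUp y).le
  have hint : ∀ x : E2, Integrable (fun y : E2 => Real.log ‖x - y‖ * f y) := fun x =>
    aux_logint hν (hk0 ν hν).1 x ((hk ν hν x).trans_lt ENNReal.ofReal_lt_top) hfm hf2'
  by_cases hint2 : Integrable (fun y : E2 => Unu ν y *
      ‖gradient (fun z => f z / Unu ν z - Psi f z) y‖ ^ 2)
  swap
  · rw [integral_undef hint2]; positivity
  rw [← ENNReal.ofReal_le_ofReal_iff (by positivity), ofReal_integral_eq_lintegral_ofReal hint2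
    (Filter.Eventually.of_forall fun y => mul_nonneg (hUp y).le (by positivity))]
  refine (lintegral_mono (aux_point hν hf hint)).trans ?_
  have hA : Integrable (fun x : E2 => 4 * (‖gradient f x‖ ^ 2 / Unu ν x) +
        8 / ν ^ 2 * ((ν ^ 2 + ‖x‖ ^ 2) * f x ^ 2)) := (hg2.const_mul 4).add (hI.const_mul _)
  have hFm := aux_FFmeas hfm
  have hGm : ∀ (i : Fin 2) (n : ℕ), Measurable (fun x : E2 => ENNReal.ofReal (1 / (ν ^ 2 + ‖x‖ ^ 2)) *
      (64 * (FF f (x + ((n : ℝ) + 1)⁻¹ • EuclideanSpace.single i 1) ^ 2 + FF f x ^ 2))) := by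
    intro i n; fun_prop
  set H := ∫ y : E2, (ν ^ 2 + ‖y‖ ^ 2) * f y ^ 2 with hHdef
  have hH0 : 0 ≤ H := integral_nonneg fun y => by positivity
  have hP : ∀ h : E2, ∫⁻ x : E2, ENNReal.ofReal (1 / (ν ^ 2 + ‖x‖ ^ 2)) * FF f (x + h) ^ 2 ≤
      ENNReal.ofReal ((K / ν) ^ 2 * H) := by
    intro h
    refine (aux_P hν (hk ν hν) hfm h).trans (le_of_eq ?_)
    rw [← ofReal_integral_eq_lintegral_ofReal hI (Filter.Eventually.of_forall fun y => by positivity),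
      ← ENNReal.ofReal_pow (by positivity), ← ENNReal.ofReal_mul (by positivity)]
  have hG : ∀ (i : Fin 2), ∫⁻ x : E2, Filter.liminf (fun n : ℕ =>
      ENNReal.ofReal (1 / (ν ^ 2 + ‖x‖ ^ 2)) *
      (64 * (FF f (x + ((n : ℝ) + 1)⁻¹ • EuclideanSpace.single i 1) ^ 2 + FF f x ^ 2))) Filter.atTop
      ≤ ENNReal.ofReal (128 * ((K / ν) ^ 2 * H)) := by
    intro i
    refine (lintegral_liminf_le (hGm i)).trans ?_
    refine Filter.liminf_le_of_le (by isBoundedDefault) ?_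
    intro b hb
    obtain ⟨n, hn⟩ := hb.exists
    refine hn.trans ?_
    have e : ∀ x : E2, ENNReal.ofReal (1 / (ν ^ 2 + ‖x‖ ^ 2)) *
      (64 * (FF f (x + ((n : ℝ) + 1)⁻¹ • EuclideanSpace.single i 1) ^ 2 + FF f x ^ 2)) =
      64 * (ENNReal.ofReal (1 / (ν ^ 2 + ‖x‖ ^ 2)) *
        FF f (x + ((n : ℝ) + 1)⁻¹ • EuclideanSpace.single i 1) ^ 2 +
        ENNReal.ofReal (1 / (ν ^ 2 + ‖x‖ ^ 2)) * FF f (x + 0) ^ 2) := by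
      intro x; rw [add_zero]; ring
    simp_rw [e]
    rw [lintegral_const_mul _ (by fun_prop), lintegral_add_left (by fun_prop)]
    refine (mul_le_mul_right (add_le_add (hP _) (hP 0)) _).trans (le_of_eq ?_)
    rw [← ENNReal.ofReal_add (by positivity) (by positivity),
      show (64 : ENNReal) = ENNReal.ofReal 64 by simp, ← ENNReal.ofReal_mul (by norm_num)]
    congr 1; ring
  have hLm : ∀ i : Fin 2, Measurable (fun x : E2 => Filter.liminf (fun n : ℕ =>
      ENNReal.ofReal (1 / (ν ^ 2 + ‖x‖ ^ 2)) *
      (64 * (FF f (x + ((n : ℝ) + 1)⁻¹ • EuclideanSpace.single i 1) ^ 2 + FF f x ^ 2)))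
      Filter.atTop) := fun i => Measurable.liminf (hGm i)
  rw [lintegral_add_left' hA.aestronglyMeasurable.aemeasurable.ennreal_ofReal,
    lintegral_add_left (hLm 0)]
  refine (add_le_add le_rfl (add_le_add (hG 0) (hG 1))).trans ?_
  rw [← ofReal_integral_eq_lintegral_ofReal hA (Filter.Eventually.of_forall fun y => by
      have := hUp y; positivity),
    integral_add (hg2.const_mul 4) (hI.const_mul _), integral_const_mul, integral_const_mul,
    ← hD, ← hHdef, ← ENNReal.ofReal_add (by positivity) (by positivity),
    ← ENNReal.ofReal_add (by positivity) (by positivity)]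
  apply ENNReal.ofReal_le_ofReal
  have hHν : H / ν ^ 2 ≤ 8 * D := by
    rw [div_le_iff₀ (by positivity)]; linarith
  have e : 4 * D + 8 / ν ^ 2 * H + (128 * ((K / ν) ^ 2 * H) + 128 * ((K / ν) ^ 2 * H)) =
    4 * D + (8 + 256 * K ^ 2) * (H / ν ^ 2) := by field_simp; ring
  rw [e]
  calc _ ≤ 4 * D + (8 + 256 * K ^ 2) * (8 * D) := by gcongr
    _ = _ := by ring
end
end

section
/- For every ν > 0 and every weakly differentiable f : ℝ² → ℝ with ∫_{ℝ²} f²/U_ν < ∞, ∫_{ℝ²} |∇f|²/U_ν < ∞ and ∫_{ℝ²} f = 0, one has ∫_{ℝ²} f (f/U_ν − Ψ_f) ≥ 0. -/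
open MeasureTheory
open scoped RealInnerProductSpace

noncomputable section

def s8J (z : ℂ) : ℝ := 4 / (1 + Complex.normSq z) ^ 2

def s8n (i : Fin 3) (z : ℂ) : ℝ :=
  ![2 * z.re, 2 * z.im, 1 - Complex.normSq z] i / (1 + Complex.normSq z)

def s8t (z w : ℂ) : ℝ := ∑ i, s8n i z * s8n i w

def s8sig : Measure ℂ := volume.withDensity (fun z => ENNReal.ofReal (s8J z))

lemma s8_pos (z : ℂ) : 0 < 1 + Complex.normSq z := by
  have := Complex.normSq_nonneg z; linarith

lemma s8J_pos (z : ℂ) : 0 < s8J z := by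
  have := s8_pos z; unfold s8J; positivity

lemma s8_cN : Continuous (fun z : ℂ => Complex.normSq z) := Complex.continuous_normSq

lemma s8J_cont : Continuous s8J := by
  unfold s8J
  exact continuous_const.div (by have := s8_cN; fun_prop) (fun z => (pow_pos (s8_pos z) 2).ne')

lemma s8n_cont (i : Fin 3) : Continuous (s8n i) := by
  unfold s8n
  refine Continuous.div ?_ (by have := s8_cN; fun_prop) (fun z => (s8_pos z).ne')
  have := s8_cN
  fin_cases i <;> simp <;> fun_prop

lemma s8t_cont : Continuous (fun p : ℂ × ℂ => s8t p.1 p.2) := by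
  unfold s8t
  have := s8n_cont
  fun_prop

lemma s8t_symm (z w : ℂ) : s8t z w = s8t w z := by
  unfold s8t; simp [mul_comm]

lemma s8n_sq (z : ℂ) : s8t z z = 1 := by
  have := s8_pos z
  unfold s8t s8n
  simp [Fin.sum_univ_three]
  field_simp
  simp [Complex.normSq_apply]; ring

lemma s8n_abs (i : Fin 3) (z : ℂ) : |s8n i z| ≤ 1 := by
  have h := s8n_sq z
  rw [s8t] at h
  have : s8n i z * s8n i z ≤ 1 := by
    rw [← h]
    exact Finset.single_le_sum (f := fun i => s8n i z * s8n i z) (fun j _ => mul_self_nonneg _) (Finset.mem_univ i)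
  exact abs_le_one_iff_mul_self_le_one.mpr this

lemma s8_one_sub (z w : ℂ) : 1 - s8t z w =
    2 * Complex.normSq (z - w) / ((1 + Complex.normSq z) * (1 + Complex.normSq w)) := by
  have := s8_pos z
  have := s8_pos w
  unfold s8t s8n
  simp [Fin.sum_univ_three]
  field_simp
  simp [Complex.normSq_apply]; ring

/-- the rotation -/
def s8psi (a w : ℂ) : ℂ := (w + a) / (1 - (starRingEnd ℂ) a * w)

lemma s8psi_den (a w : ℂ) (h : 1 - (starRingEnd ℂ) a * w ≠ 0) :
    1 + Complex.normSq (s8psi a w) =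
      (1 + Complex.normSq a) * (1 + Complex.normSq w) / Complex.normSq (1 - (starRingEnd ℂ) a * w) := by
  have h' : Complex.normSq (1 - (starRingEnd ℂ) a * w) ≠ 0 := by simpa using h
  unfold s8psi
  rw [map_div₀]
  have key : Complex.normSq (1 - (starRingEnd ℂ) a * w) + Complex.normSq (w + a) =
    (1 + Complex.normSq a) * (1 + Complex.normSq w) := by
    simp [Complex.normSq_apply]; ring
  rw [← key]
  generalize Complex.normSq (1 - (starRingEnd ℂ) a * w) = D at *
  field_simp

lemma s8psi_n (a w : ℂ) (h : 1 - (starRingEnd ℂ) a * w ≠ 0) (i : Fin 3) :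
    s8n i (s8psi a w) = ![2 * ((w + a) * (1 - a * (starRingEnd ℂ) w)).re,
      2 * ((w + a) * (1 - a * (starRingEnd ℂ) w)).im,
      Complex.normSq (1 - (starRingEnd ℂ) a * w) - Complex.normSq (w + a)] i /
       ((1 + Complex.normSq a) * (1 + Complex.normSq w)) := by
  have h' : Complex.normSq (1 - (starRingEnd ℂ) a * w) ≠ 0 := by simpa using h
  have h1 := s8_pos a
  have h2 := s8_pos w
  have e : s8psi a w = ((w + a) * (1 - a * (starRingEnd ℂ) w)) * ((Complex.normSq (1 - (starRingEnd ℂ) a * w))⁻¹ : ℝ) := by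
    unfold s8psi
    rw [div_eq_mul_inv, Complex.inv_def]
    simp [mul_assoc]
  unfold s8n
  rw [s8psi_den a w h]
  have e3 : Complex.normSq (s8psi a w) = Complex.normSq (w + a) / Complex.normSq (1 - (starRingEnd ℂ) a * w) := by
    unfold s8psi; rw [map_div₀]
  rw [e3, e]
  generalize Complex.normSq (1 - (starRingEnd ℂ) a * w) = D at *
  fin_cases i
  · simp only [Complex.re_mul_ofReal, Fin.zero_eta, Matrix.cons_val_zero]
    field_simp
  · simp only [Complex.im_mul_ofReal, Fin.mk_one, Matrix.cons_val_one, Matrix.cons_val_zero]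
    field_simp
  · simp only [Fin.reduceFinMk, Matrix.cons_val]
    field_simp

lemma s8psi_avg (a w : ℂ) (h : 1 - (starRingEnd ℂ) a * w ≠ 0) (h2 : 1 + (starRingEnd ℂ) a * w ≠ 0)
    (i : Fin 3) : s8n i (s8psi a w) + s8n i (s8psi a (-w)) = 2 * (s8n i a * s8n 2 w) := by
  rw [s8psi_n a w h, s8psi_n a (-w) (by simpa using h2)]
  have h1 := s8_pos a
  have h2 := s8_pos w
  unfold s8n
  fin_cases i <;> simp <;> field_simp <;> simp [Complex.normSq_apply] <;> ring

lemma s8t_psi (a w : ℂ) (h : 1 - (starRingEnd ℂ) a * w ≠ 0) :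
    s8t a (s8psi a w) = s8n 2 w := by
  have h1 := s8_pos a
  have h2 := s8_pos w
  unfold s8t
  simp only [s8psi_n a w h]
  unfold s8n
  simp [Fin.sum_univ_three]; field_simp; simp [Complex.normSq_apply] ; ring

lemma s8psi_inv1 (a w : ℂ) (h : 1 - (starRingEnd ℂ) a * w ≠ 0) :
    1 + (starRingEnd ℂ) a * s8psi a w = (1 + Complex.normSq a : ℝ) / (1 - (starRingEnd ℂ) a * w) := by
  unfold s8psi
  push_cast
  rw [Complex.normSq_eq_conj_mul_self]
  field_simp
  ring

lemma s8_posC (a : ℂ) : ((1 + Complex.normSq a : ℝ) : ℂ) ≠ 0 := by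
  exact_mod_cast (s8_pos a).ne'

lemma s8psi_inv (a w : ℂ) (h : 1 - (starRingEnd ℂ) a * w ≠ 0) :
    s8psi (-a) (s8psi a w) = w := by
  have h1 := s8psi_inv1 a w h
  have h2 := s8_posC a
  have h3 : 1 - (starRingEnd ℂ) (-a) * s8psi a w = (1 + Complex.normSq a : ℝ) / (1 - (starRingEnd ℂ) a * w) := by
    rw [← h1]; simp
  rw [s8psi, h3, s8psi, div_div_eq_mul_div, div_eq_iff h2]
  rw [add_mul, div_mul_cancel₀ _ h]
  push_cast
  rw [Complex.normSq_eq_conj_mul_self]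
  ring

def s8S (a : ℂ) : Set ℂ := {w | 1 - (starRingEnd ℂ) a * w ≠ 0}

lemma s8S_open (a : ℂ) : IsOpen (s8S a) := by
  unfold s8S
  exact isOpen_ne_fun (by fun_prop) (by fun_prop)

lemma s8S_null (a : ℂ) : volume (s8S a)ᶜ = 0 := by
  apply Set.Subsingleton.measure_zero
  intro x hx y hy
  simp only [s8S, Set.mem_compl_iff, Set.mem_ofPred_eq, not_not] at hx hy
  have ha : (starRingEnd ℂ) a ≠ 0 := by
    intro h; simp [h] at hx
  apply mul_left_cancel₀ ha
  linear_combination hy - hx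

lemma s8S_ae (a : ℂ) : s8S a =ᵐ[volume] Set.univ := by
  rw [ae_eq_univ]; exact s8S_null a

lemma s8psi_image (a : ℂ) : s8psi a '' s8S a = s8S (-a) := by
  ext y
  constructor
  · rintro ⟨w, hw, rfl⟩
    have h1 := s8psi_inv1 a w hw
    simp only [s8S, Set.mem_ofPred_eq, map_neg, neg_mul, sub_neg_eq_add]
    rw [h1]
    exact div_ne_zero (s8_posC a) hw
  · intro hy
    refine ⟨s8psi (-a) y, ?_, by simpa using s8psi_inv (-a) y hy⟩
    have h1 := s8psi_inv1 (-a) y hy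
    simp only [s8S, Set.mem_ofPred_eq, map_neg, neg_mul, sub_neg_eq_add] at hy h1 ⊢
    rw [sub_eq_add_neg, h1]
    exact div_ne_zero (by simpa using s8_posC (-a)) hy

lemma s8psi_meas (a : ℂ) : Measurable (s8psi a) := by
  unfold s8psi; fun_prop

lemma s8psi_deriv (a w : ℂ) (h : w ∈ s8S a) :
    HasDerivAt (s8psi a) ((1 + Complex.normSq a : ℝ) / (1 - (starRingEnd ℂ) a * w) ^ 2) w := by
  have h1 : HasDerivAt (fun w : ℂ => w + a) 1 w := (hasDerivAt_id w).add_const a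
  have h2 : HasDerivAt (fun w : ℂ => 1 - (starRingEnd ℂ) a * w) (-((starRingEnd ℂ) a)) w := by
    simpa using ((hasDerivAt_id w).const_mul ((starRingEnd ℂ) a)).const_sub 1
  have := h1.div h2 h
  convert! this using 1
  push_cast
  rw [Complex.normSq_eq_conj_mul_self]
  congr 1
  ring

lemma s8psi_J (a w : ℂ) (h : w ∈ s8S a) :
    Complex.normSq ((1 + Complex.normSq a : ℝ) / (1 - (starRingEnd ℂ) a * w) ^ 2) * s8J (s8psi a w) = s8J w := by
  have h' : Complex.normSq (1 - (starRingEnd ℂ) a * w) ≠ 0 := by simpa [s8S] using h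
  have h1 := s8_pos a
  have h2 := s8_pos w
  unfold s8J
  rw [s8psi_den a w h, map_div₀, Complex.normSq_ofReal, map_pow]
  generalize Complex.normSq (1 - (starRingEnd ℂ) a * w) = D at *
  field_simp

lemma s8_map_psi (a : ℂ) : MeasurePreserving (s8psi a) s8sig s8sig := by
  refine ⟨s8psi_meas a, ?_⟩
  ext s hs
  rw [Measure.map_apply (s8psi_meas a) hs]
  unfold s8sig
  rw [withDensity_apply _ hs, withDensity_apply _ (s8psi_meas a hs)]
  rw [← lintegral_indicator hs, ← lintegral_indicator (s8psi_meas a hs)]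
  symm
  rw [← setLIntegral_univ, ← setLIntegral_congr (s8S_ae (-a)), ← s8psi_image]
  rw [lintegral_image_eq_lintegral_abs_det_fderiv_mul volume (s8S_open a).measurableSet
    (fun w hw => ((s8psi_deriv a w hw).hasFDerivAt.restrictScalars ℝ).hasFDerivWithinAt)]
  · rw [← setLIntegral_univ (Set.indicator _ _), ← setLIntegral_congr (s8S_ae a)]
    refine setLIntegral_congr_fun (s8S_open a).measurableSet (fun w hw => ?_)
    have hd : ((ContinuousLinearMap.toSpanSingleton ℂ (((1 + Complex.normSq a : ℝ) : ℂ) / (1 - (starRingEnd ℂ) a * w) ^ 2)).restrictScalars ℝ).det = Complex.normSq ((1 + Complex.normSq a : ℝ) / (1 - (starRingEnd ℂ) a * w) ^ 2) := by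
      simp [ContinuousLinearMap.det, LinearMap.det_restrictScalars, Algebra.norm_complex_eq]
    simp only [hd]
    by_cases hm : s8psi a w ∈ s
    · rw [Set.indicator_of_mem hm, Set.indicator_of_mem (show w ∈ s8psi a ⁻¹' s from hm), abs_of_nonneg (Complex.normSq_nonneg _), ← ENNReal.ofReal_mul (Complex.normSq_nonneg _), s8psi_J a w hw]
    · rw [Set.indicator_of_notMem hm, Set.indicator_of_notMem (show w ∉ s8psi a ⁻¹' s from hm), mul_zero]
  · intro x hx y hy hxy
    rw [← s8psi_inv a x hx, hxy, s8psi_inv a y hy]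

lemma s8_map_neg : MeasurePreserving (fun z : ℂ => -z) s8sig s8sig := by
  refine ⟨measurable_neg, ?_⟩
  ext s hs
  rw [Measure.map_apply measurable_neg hs]
  unfold s8sig
  rw [withDensity_apply _ hs, withDensity_apply _ (measurable_neg hs)]
  have := (Measure.measurePreserving_neg (volume : Measure ℂ)).setLIntegral_comp_preimage hs
    (f := fun z => ENNReal.ofReal (s8J z)) (by have := s8J_cont.measurable; fun_prop)
  rw [← this]
  simp [s8J]

def s8T (r : ℝ) : ℝ := (1 - r ^ 2) / (1 + r ^ 2)

lemma s8T_image : s8T '' Set.Ioi 0 = Set.Ioo (-1) 1 := by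
  ext t
  constructor
  · rintro ⟨r, hr, rfl⟩
    have hr : 0 < r := hr
    unfold s8T
    constructor
    · rw [lt_div_iff₀ (by positivity)]; nlinarith
    · rw [div_lt_iff₀ (by positivity)]; nlinarith
  · rintro ⟨h1, h2⟩
    have h3 : 0 < (1 - t) / (1 + t) := div_pos (by linarith) (by linarith)
    refine ⟨√((1 - t) / (1 + t)), Real.sqrt_pos.mpr h3, ?_⟩
    unfold s8T
    rw [Real.sq_sqrt h3.le]
    have : 1 + t ≠ 0 := by linarith
    field_simp
    ring

lemma s8T_inj : Set.InjOn s8T (Set.Ioi 0) := by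
  intro x hx y hy h
  have hx : 0 < x := hx
  have hy : 0 < y := hy
  unfold s8T at h
  rw [div_eq_div_iff (by positivity) (by positivity)] at h
  have : x ^ 2 = y ^ 2 := by linarith
  exact (pow_left_inj₀ hx.le hy.le two_ne_zero).mp this

lemma s8T_deriv (r : ℝ) : HasDerivAt s8T (-(4 * r / (1 + r ^ 2) ^ 2)) r := by
  have h1 : HasDerivAt (fun r : ℝ => 1 - r ^ 2) (-(2 * r)) r := by
    simpa using ((hasDerivAt_id r).pow 2).const_sub 1
  have h2 : HasDerivAt (fun r : ℝ => 1 + r ^ 2) (2 * r) r := by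
    simpa using ((hasDerivAt_id r).pow 2).const_add 1
  have := h1.div h2 (by positivity)
  convert! this using 1
  field_simp
  ring

lemma s8_map_n : MeasurePreserving (s8n 2) s8sig
    (ENNReal.ofReal (2 * Real.pi) • volume.restrict (Set.Ioo (-1 : ℝ) 1)) := by
  have hm := (s8n_cont 2).measurable
  refine ⟨hm, ?_⟩
  ext s hs
  rw [Measure.map_apply hm hs]
  unfold s8sig
  rw [withDensity_apply _ (hm hs), ← lintegral_indicator (hm hs),
    ← Complex.lintegral_comp_polarCoord_symm, Measure.smul_apply, smul_eq_mul]
  have e1 : volume.restrict (Set.Ioo (-1 : ℝ) 1) s = ∫⁻ r in Set.Ioi (0:ℝ),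
      ENNReal.ofReal (4 * r / (1 + r ^ 2) ^ 2) * s.indicator 1 (s8T r) := by
    rw [← lintegral_indicator_one hs, ← s8T_image,
      lintegral_image_eq_lintegral_abs_deriv_mul measurableSet_Ioi
        (fun r _ => (s8T_deriv r).hasDerivWithinAt) s8T_inj]
    refine setLIntegral_congr_fun measurableSet_Ioi (fun r hr => ?_)
    have hr : 0 < r := hr
    simp only [abs_neg]
    rw [abs_of_nonneg (by positivity)]
  have hT : Measurable s8T := by unfold s8T; fun_prop
  have e2 : ∀ p ∈ polarCoord.target, ENNReal.ofReal p.1 • (s8n 2 ⁻¹' s).indicator (fun z => ENNReal.ofReal (s8J z))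
      (Complex.polarCoord.symm p) = (ENNReal.ofReal (4 * p.1 / (1 + p.1 ^ 2) ^ 2) * s.indicator 1 (s8T p.1)) * 1 := by
    intro p hp
    have hp1 : 0 < p.1 := hp.1
    have hN : Complex.normSq (Complex.polarCoord.symm p) = p.1 ^ 2 := by
      rw [Complex.normSq_eq_norm_sq, Complex.norm_polarCoord_symm, sq_abs]
    have hn : s8n 2 (Complex.polarCoord.symm p) = s8T p.1 := by
      simp only [s8n, hN, s8T, Matrix.cons_val]
    by_cases hmm : s8T p.1 ∈ s
    · rw [Set.indicator_of_mem hmm, Set.indicator_of_mem (by rw [Set.mem_preimage, hn]; exact hmm)]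
      rw [smul_eq_mul, ← ENNReal.ofReal_mul hp1.le, s8J, hN]
      simp only [Pi.one_apply, mul_one]
      congr 1; ring
    · rw [Set.indicator_of_notMem hmm, Set.indicator_of_notMem (by rw [Set.mem_preimage, hn]; exact hmm)]
      simp
  rw [setLIntegral_congr_fun polarCoord.open_target.measurableSet e2, polarCoord_target, Measure.volume_eq_prod,
    ← Measure.prod_restrict, lintegral_prod_mul (f := fun r : ℝ => ENNReal.ofReal (4 * r / (1 + r ^ 2) ^ 2) * s.indicator 1 (s8T r)) (g := fun _ => 1), ← e1, mul_comm]
  · congr 1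
    simp [two_mul]
  · refine Measurable.aemeasurable (Measurable.mul (by fun_prop) ?_)
    exact (measurable_one.indicator hs).comp hT
  · fun_prop

instance s8_fin : IsFiniteMeasure s8sig := by
  constructor
  rw [← Set.preimage_univ (f := s8n 2), s8_map_n.measure_preimage MeasurableSet.univ.nullMeasurableSet]
  simp
  exact ENNReal.mul_lt_top (by finiteness) (by finiteness)

lemma s8sig_ac : s8sig ≪ volume := withDensity_absolutelyContinuous _ _

lemma s8S_ae2 (a : ℂ) : ∀ᵐ w ∂s8sig, 1 - (starRingEnd ℂ) a * w ≠ 0 := by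
  have h : ∀ᵐ w ∂(volume : Measure ℂ), 1 - (starRingEnd ℂ) a * w ≠ 0 := by
    rw [ae_iff]
    exact s8S_null a
  exact s8sig_ac.ae_le h

lemma s8t_cont2 (a : ℂ) : Continuous (s8t a) := by
  have := s8n_cont
  unfold s8t; fun_prop

lemma s8_map_t (a : ℂ) : MeasurePreserving (s8t a) s8sig
    (ENNReal.ofReal (2 * Real.pi) • volume.restrict (Set.Ioo (-1 : ℝ) 1)) := by
  refine ⟨(s8t_cont2 a).measurable, ?_⟩
  rw [← s8_map_n.map_eq]
  nth_rewrite 1 [← (s8_map_psi a).map_eq]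
  rw [Measure.map_map (s8t_cont2 a).measurable (s8psi_meas a)]
  apply Measure.map_congr
  filter_upwards [s8S_ae2 a] with w hw
  exact s8t_psi a w hw

lemma s8_int_smul {F : ℝ → ℝ} (hF : IntegrableOn F (Set.Ioo (-1) 1)) :
    Integrable F (ENNReal.ofReal (2 * Real.pi) • volume.restrict (Set.Ioo (-1 : ℝ) 1)) :=
  Integrable.smul_measure hF (by finiteness)

lemma s8_Zint {F : ℝ → ℝ} (hF : IntegrableOn F (Set.Ioo (-1) 1)) (a : ℂ) :
    Integrable (fun y => F (s8t a y)) s8sig :=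
  (s8_map_t a).integrable_comp_of_integrable (s8_int_smul hF)

lemma s8_Z {F : ℝ → ℝ} (hF : IntegrableOn F (Set.Ioo (-1) 1)) (a : ℂ) :
    ∫ y, F (s8t a y) ∂s8sig = 2 * Real.pi * ∫ t in Set.Ioo (-1 : ℝ) 1, F t := by
  have h := integral_map (μ := s8sig) (φ := s8t a) (s8t_cont2 a).measurable.aemeasurable (f := F)
    (by rw [(s8_map_t a).map_eq]; exact (s8_int_smul hF).aestronglyMeasurable)
  rw [← h, (s8_map_t a).map_eq, integral_smul_measure, ENNReal.toReal_ofReal (by positivity), smul_eq_mul]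

lemma s8_Zn {F : ℝ → ℝ} (hF : IntegrableOn F (Set.Ioo (-1) 1)) :
    ∫ y, F (s8n 2 y) ∂s8sig = 2 * Real.pi * ∫ t in Set.Ioo (-1 : ℝ) 1, F t := by
  have h := integral_map (μ := s8sig) (φ := s8n 2) (s8n_cont 2).measurable.aemeasurable (f := F)
    (by rw [s8_map_n.map_eq]; exact (s8_int_smul hF).aestronglyMeasurable)
  rw [← h, s8_map_n.map_eq, integral_smul_measure, ENNReal.toReal_ofReal (by positivity), smul_eq_mul]

lemma s8_mul_n {G : ℂ → ℝ} (hG : Integrable G s8sig) (i : Fin 3) :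
    Integrable (fun y => G y * s8n i y) s8sig :=
  hG.mul_bdd (c := 1) (s8n_cont i).aestronglyMeasurable (ae_of_all _ (fun y => s8n_abs i y))

lemma s8_Z2 {F : ℝ → ℝ} (hFm : Measurable F) (hF : IntegrableOn F (Set.Ioo (-1) 1)) (a : ℂ) (i : Fin 3) :
    ∫ y, F (s8t a y) * s8n i y ∂s8sig = s8n i a * (2 * Real.pi * ∫ t in Set.Ioo (-1 : ℝ) 1, F t * t) := by
  have hFt : IntegrableOn (fun t => F t * t) (Set.Ioo (-1 : ℝ) 1) := by
    apply Integrable.mul_bdd (c := 1) hF (by fun_prop)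
    filter_upwards [ae_restrict_mem measurableSet_Ioo] with t ht
    rw [Real.norm_eq_abs, abs_le]; exact ⟨ht.1.le, ht.2.le⟩
  have hn := s8n_cont
  have hmn : ∀ i, Measurable (s8n i) := fun i => (hn i).measurable
  have hmp := s8psi_meas
  have hint : Integrable (fun w => F (s8n 2 w) * s8n i (s8psi a w)) s8sig := by
    apply Integrable.mul_bdd (c := 1)
    · exact s8_map_n.integrable_comp_of_integrable (s8_int_smul hF)
    · exact ((hmn i).comp (hmp a)).aestronglyMeasurable
    · exact ae_of_all _ (fun y => s8n_abs i _)
  have hm2 : Measurable (fun w => F (s8n 2 w) * s8n i (s8psi a w)) :=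
    (hFm.comp (hmn 2)).mul ((hmn i).comp (hmp a))
  have hsy : ∀ w, s8n 2 (-w) = s8n 2 w := by intro w; simp [s8n]
  have e1 : ∫ y, F (s8t a y) * s8n i y ∂s8sig = ∫ w, F (s8n 2 w) * s8n i (s8psi a w) ∂s8sig := by
    have h := integral_map (μ := s8sig) (φ := s8psi a) (hmp a).aemeasurable
      (f := fun y => F (s8t a y) * s8n i y)
      (((hFm.comp (s8t_cont2 a).measurable).mul (hmn i)).aestronglyMeasurable)
    rw [(s8_map_psi a).map_eq] at h
    rw [h]
    apply integral_congr_ae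
    filter_upwards [s8S_ae2 a] with w hw
    simp only [s8t_psi a w hw]
  have e2 : ∫ w, F (s8n 2 w) * s8n i (s8psi a w) ∂s8sig = ∫ w, F (s8n 2 w) * s8n i (s8psi a (-w)) ∂s8sig := by
    have h := integral_map (μ := s8sig) (φ := fun z : ℂ => -z) measurable_neg.aemeasurable
      (f := fun w => F (s8n 2 w) * s8n i (s8psi a w)) hm2.aestronglyMeasurable
    rw [s8_map_neg.map_eq] at h
    rw [h]
    simp only [hsy]
  have hint2 : Integrable (fun w => F (s8n 2 w) * s8n i (s8psi a (-w))) s8sig := by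
    have := s8_map_neg.integrable_comp_of_integrable hint
    simpa [Function.comp_def, hsy] using this
  have e3 : (∫ w, F (s8n 2 w) * s8n i (s8psi a w) ∂s8sig) + ∫ w, F (s8n 2 w) * s8n i (s8psi a (-w)) ∂s8sig
     = 2 * s8n i a * ∫ w, F (s8n 2 w) * s8n 2 w ∂s8sig := by
    rw [← integral_add hint hint2, ← integral_const_mul]
    apply integral_congr_ae
    filter_upwards [s8S_ae2 a, s8S_ae2 (-a)] with w hw hw'
    have := s8psi_avg a w hw (by simpa using hw') i
    linear_combination F (s8n 2 w) * this
  rw [s8_Zn (F := fun t => F t * t) hFt] at e3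
  rw [e1]
  linarith

/-- the profile -/
def s8p (t : ℝ) : ℝ := -Real.log (1 - t) - 3 / 2 * t + 19 / 100

lemma s8p_meas : Measurable s8p := by unfold s8p; fun_prop

lemma s8p_nonneg {t : ℝ} (ht : t < 1) : 0 ≤ s8p t := by
  unfold s8p
  have h1 : Real.log (3 / 2 * (1 - t)) ≤ 3 / 2 * (1 - t) - 1 := Real.log_le_sub_one_of_pos (by linarith)
  rw [Real.log_mul (by norm_num) (by linarith)] at h1
  have h2 := Real.one_sub_inv_le_log_of_pos (show (0:ℝ) < 3 / 2 by norm_num)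
  norm_num at h2
  linarith

lemma s8_logint : IntervalIntegrable (fun t : ℝ => Real.log (1 - t)) volume (-1) 1 := by
  have := (intervalIntegral.intervalIntegrable_log' (a := 0) (b := 2)).comp_sub_left 1
  norm_num at this
  exact this.symm

lemma s8_setint (F : ℝ → ℝ) : ∫ t in Set.Ioo (-1 : ℝ) 1, F t = ∫ t in (-1:ℝ)..1, F t := by
  rw [intervalIntegral.integral_of_le (by norm_num), integral_Ioc_eq_integral_Ioo]

lemma s8_II {F : ℝ → ℝ} (h : IntervalIntegrable F volume (-1) 1) : IntegrableOn F (Set.Ioo (-1) 1) := by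
  rw [intervalIntegrable_iff_integrableOn_Ioo_of_le (by norm_num)] at h
  exact h

lemma s8p_ii : IntervalIntegrable s8p volume (-1) 1 := by
  unfold s8p
  exact (s8_logint.neg.sub (Continuous.intervalIntegrable (by fun_prop) _ _)).add (Continuous.intervalIntegrable (by fun_prop) _ _)

lemma s8p_int : IntegrableOn s8p (Set.Ioo (-1) 1) := s8_II s8p_ii

lemma s8_log1 : ∫ t in (-1:ℝ)..1, Real.log (1 - t) = 2 * Real.log 2 - 2 := by
  rw [intervalIntegral.integral_comp_sub_left (fun x => Real.log x) 1]
  norm_num [integral_log]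

lemma s8_xlog : ∫ x in (0:ℝ)..2, x * Real.log x = 2 * Real.log 2 - 1 := by
  have := intervalIntegral.integral_eq_sub_of_hasDerivAt_of_le (a := 0) (b := 2)
    (f := fun x : ℝ => x * (x * Real.log x) / 2 - x ^ 2 / 4) (f' := fun x => x * Real.log x) (by norm_num)
    (by have := Real.continuous_mul_log; fun_prop) (by
      intro x hx
      have hx0 : x ≠ 0 := hx.1.ne'
      have h1 := ((hasDerivAt_id x).mul (Real.hasDerivAt_mul_log hx0)).div_const 2
      have h2 := ((hasDerivAt_id x).pow 2).div_const 4
      convert! h1.sub h2 using 1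
      simp
      ring)
    (Real.continuous_mul_log.intervalIntegrable _ _)
  rw [this]; norm_num

lemma s8_log2 : ∫ t in (-1:ℝ)..1, Real.log (1 - t) * t = -1 := by
  have h := intervalIntegral.integral_comp_sub_left (a := -1) (b := 1) (fun x => Real.log x * (1 - x)) 1
  simp only [sub_sub_cancel] at h
  rw [h]
  norm_num
  have : ∀ x : ℝ, Real.log x * (1 - x) = Real.log x - x * Real.log x := by intro x; ring
  simp only [this]
  rw [intervalIntegral.integral_sub intervalIntegral.intervalIntegrable_log' (Real.continuous_mul_log.intervalIntegrable _ _), s8_xlog, integral_log]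
  norm_num

lemma s8p_I : ∫ t in Set.Ioo (-1:ℝ) 1, s8p t ≤ 1 := by
  rw [s8_setint]
  unfold s8p
  have hl : IntervalIntegrable (fun t : ℝ => -Real.log (1 - t)) volume (-1) 1 := s8_logint.neg
  rw [intervalIntegral.integral_add (hl.sub (Continuous.intervalIntegrable (by fun_prop) _ _)) (Continuous.intervalIntegrable (by fun_prop) _ _),
    intervalIntegral.integral_sub hl (Continuous.intervalIntegrable (by fun_prop) _ _),
    intervalIntegral.integral_neg, s8_log1]
  have := Real.log_two_gt_d9
  rw [intervalIntegral.integral_const_mul, integral_id]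
  norm_num
  linarith

lemma s8p_It : ∫ t in Set.Ioo (-1:ℝ) 1, s8p t * t = 0 := by
  rw [s8_setint]
  have e : ∀ t, s8p t * t = -(Real.log (1 - t) * t) + (- (3 / 2) * t ^ 2 + 19 / 100 * t) := by
    intro t; unfold s8p; ring
  simp only [e]
  have hl : IntervalIntegrable (fun t : ℝ => -(Real.log (1 - t) * t)) volume (-1) 1 :=
    (IntervalIntegrable.mul_continuousOn s8_logint (by fun_prop)).neg
  rw [intervalIntegral.integral_add hl (Continuous.intervalIntegrable (by fun_prop) _ _),
    intervalIntegral.integral_neg, s8_log2,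
    intervalIntegral.integral_add (Continuous.intervalIntegrable (by fun_prop) _ _) (Continuous.intervalIntegrable (by fun_prop) _ _), intervalIntegral.integral_const_mul,
    intervalIntegral.integral_const_mul, integral_id]
  norm_num

lemma s8_P1 (a : ℂ) : Integrable (fun y => s8p (s8t a y)) s8sig := s8_Zint s8p_int a

lemma s8_P2 (a : ℂ) : ∫ y, |s8p (s8t a y)| ∂s8sig ≤ 2 * Real.pi := by
  rw [s8_Z (F := fun t => |s8p t|) s8p_int.abs]
  have : ∫ t in Set.Ioo (-1:ℝ) 1, |s8p t| = ∫ t in Set.Ioo (-1:ℝ) 1, s8p t :=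
    setIntegral_congr_fun measurableSet_Ioo (fun t ht => abs_of_nonneg (s8p_nonneg ht.2))
  rw [this]
  have := s8p_I
  have := Real.pi_pos
  nlinarith

lemma s8_P3 (a : ℂ) (i : Fin 3) : ∫ y, s8p (s8t a y) * s8n i y ∂s8sig = 0 := by
  rw [s8_Z2 s8p_meas s8p_int, s8p_It]; simp

lemma s8_P4 (a : ℂ) (i : Fin 3) : ∫ y, s8t a y * s8n i y ∂s8sig = 4 * Real.pi / 3 * s8n i a := by
  have := s8_Z2 (F := fun t => t) measurable_id (s8_II (Continuous.intervalIntegrable (by fun_prop) _ _)) a i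
  rw [this, s8_setint]
  have : ∀ t : ℝ, t * t = t ^ 2 := fun t => by ring
  simp only [this]
  norm_num
  ring

lemma s8_P5 (i : Fin 3) : ∫ y, s8n i y ∂s8sig = 0 := by
  have h1 := fun a => s8_Z2 (F := fun _ => 1) measurable_const (s8_II (Continuous.intervalIntegrable (by fun_prop) _ _)) a i
  have := h1 0
  rw [s8_setint] at this
  simpa using this

lemma s8_int3 {X : Type*} [MeasurableSpace X] {μ : Measure X} {A B C : X → ℝ} (hA : Integrable A μ)
    (hB : Integrable B μ) (hC : Integrable C μ) (a b c : ℝ) :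
    Integrable (fun x => a * A x + b * B x + c * C x) μ ∧
    ∫ x, (a * A x + b * B x + c * C x) ∂μ = a * ∫ x, A x ∂μ + b * ∫ x, B x ∂μ + c * ∫ x, C x ∂μ := by
  have h1 : Integrable (fun x => a * A x) μ := hA.const_mul _
  have h2 : Integrable (fun x => b * B x) μ := hB.const_mul _
  have h3 : Integrable (fun x => c * C x) μ := hC.const_mul _
  have h12 : Integrable (fun x => a * A x + b * B x) μ := h1.add h2
  refine ⟨h12.add h3, ?_⟩
  rw [integral_add h12 h3, integral_add h1 h2, integral_const_mul, integral_const_mul, integral_const_mul]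

def s8K (q : ℂ × ℂ) : ℝ := s8p (s8t q.1 q.2)

lemma s8K_meas : Measurable s8K := s8p_meas.comp s8t_cont.measurable

lemma s8K_swap (q : ℂ × ℂ) : s8K q.swap = s8K q := by
  unfold s8K; simp [s8t_symm]

lemma s8_D00 {u : ℂ → ℝ} (hu : Measurable u) (hu2 : Integrable (fun z => u z ^ 2) s8sig) :
    Integrable (fun q : ℂ × ℂ => |s8K q| * u q.1 ^ 2) (s8sig.prod s8sig) := by
  have hK := s8K_meas
  rw [integrable_prod_iff (Measurable.aestronglyMeasurable (by fun_prop))]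
  constructor
  · refine ae_of_all _ (fun z => ?_)
    have h : Integrable (fun w => |s8K (z, w)|) s8sig := (s8_P1 z).abs
    exact h.mul_const (u z ^ 2)
  · obtain ⟨c, hc⟩ : ∃ c : ℝ, ∀ z, ∫ w, |s8K (z, w)| ∂s8sig = c :=
      ⟨_, fun z => s8_Z (F := fun t => |s8p t|) s8p_int.abs z⟩
    have : ∀ z, ∫ w, ‖|s8K (z, w)| * u z ^ 2‖ ∂s8sig = c * u z ^ 2 := by
      intro z
      rw [← hc z, ← integral_mul_const]
      congr 1; ext w
      rw [Real.norm_eq_abs, abs_of_nonneg (mul_nonneg (abs_nonneg _) (sq_nonneg _))]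
    simp only [this]
    exact hu2.const_mul _

lemma s8_D01 {u : ℂ → ℝ} (hu : Measurable u) (hu2 : Integrable (fun z => u z ^ 2) s8sig) :
    Integrable (fun q : ℂ × ℂ => |s8K q| * u q.2 ^ 2) (s8sig.prod s8sig) := by
  have := (s8_D00 hu hu2).swap
  simpa [Function.comp_def, s8K_swap] using this

lemma s8_D02 {u : ℂ → ℝ} (hu : Measurable u) (hu2 : Integrable (fun z => u z ^ 2) s8sig) :
    ∫ q : ℂ × ℂ, |s8K q| * u q.1 ^ 2 ∂(s8sig.prod s8sig) ≤ 2 * Real.pi * ∫ z, u z ^ 2 ∂s8sig := by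
  rw [integral_prod _ (s8_D00 hu hu2), ← integral_const_mul]
  apply integral_mono (s8_D00 hu hu2).integral_prod_left (hu2.const_mul _)
  intro z
  simp only [integral_mul_const]
  exact mul_le_mul_of_nonneg_right (s8_P2 z) (sq_nonneg _)

lemma s8_D03 {u : ℂ → ℝ} : ∫ q : ℂ × ℂ, |s8K q| * u q.2 ^ 2 ∂(s8sig.prod s8sig) =
    ∫ q : ℂ × ℂ, |s8K q| * u q.1 ^ 2 ∂(s8sig.prod s8sig) := by
  have := integral_prod_swap (μ := s8sig) (ν := s8sig) (fun q : ℂ × ℂ => |s8K q| * u q.1 ^ 2)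
  rw [← this]
  simp [s8K_swap]

lemma s8_D0 {u v : ℂ → ℝ} (hu : Measurable u) (hu2 : Integrable (fun z => u z ^ 2) s8sig)
    (hv : Measurable v) (hv2 : Integrable (fun z => v z ^ 2) s8sig) :
    Integrable (fun q : ℂ × ℂ => s8K q * (u q.1 * v q.2)) (s8sig.prod s8sig) := by
  have hK := s8K_meas
  refine Integrable.mono' ((s8_D00 hu hu2).add (s8_D01 hv hv2)) (Measurable.aestronglyMeasurable (by fun_prop)) (ae_of_all _ fun q => ?_)
  simp only [Pi.add_apply, Real.norm_eq_abs, abs_mul]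
  rw [← mul_add]
  apply mul_le_mul_of_nonneg_left _ (abs_nonneg _)
  rw [← sq_abs (u q.1), ← sq_abs (v q.2)]
  nlinarith [sq_nonneg (|u q.1| - |v q.2|), sq_nonneg (|u q.1|), sq_nonneg (|v q.2|)]

lemma s8_schur {u : ℂ → ℝ} (hu : Measurable u) (hu2 : Integrable (fun z => u z ^ 2) s8sig) :
    ∫ q : ℂ × ℂ, s8K q * (u q.1 * u q.2) ∂(s8sig.prod s8sig) ≤ 2 * Real.pi * ∫ z, u z ^ 2 ∂s8sig := by
  have h1 : ∫ q : ℂ × ℂ, s8K q * (u q.1 * u q.2) ∂(s8sig.prod s8sig) ≤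
     ∫ q : ℂ × ℂ, (1/2) * (|s8K q| * u q.1 ^ 2 + |s8K q| * u q.2 ^ 2) ∂(s8sig.prod s8sig) := by
    apply integral_mono (s8_D0 hu hu2 hu hu2) (((s8_D00 hu hu2).add (s8_D01 hu hu2)).const_mul _)
    intro q
    simp only [Pi.add_apply]
    refine (le_abs_self _).trans ?_
    rw [abs_mul, abs_mul, ← sq_abs (u q.1), ← sq_abs (u q.2)]
    nlinarith [mul_nonneg (abs_nonneg (s8K q)) (sq_nonneg (|u q.1| - |u q.2|))]
  rw [integral_const_mul, integral_add (s8_D00 hu hu2) (s8_D01 hu hu2), s8_D03] at h1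
  linarith [s8_D02 hu hu2]

def s8v (m : Fin 3 → ℝ) (z : ℂ) : ℝ := ∑ i, m i * s8n i z

lemma s8v_cont (m : Fin 3 → ℝ) : Continuous (s8v m) := by
  have := s8n_cont
  unfold s8v; fun_prop

lemma s8_bdd {h : ℂ → ℝ} (hc : Continuous h) (C : ℝ) (hb : ∀ z, |h z| ≤ C) : Integrable h s8sig :=
  Integrable.of_bound hc.aestronglyMeasurable C (ae_of_all _ hb)

lemma s8v_bdd (m : Fin 3 → ℝ) (z : ℂ) : |s8v m z| ≤ ∑ i, |m i| := by
  unfold s8v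
  refine (Finset.abs_sum_le_sum_abs _ _).trans (Finset.sum_le_sum fun i _ => ?_)
  rw [abs_mul]
  exact mul_le_of_le_one_right (abs_nonneg _) (s8n_abs i z)

lemma s8v_sq (m : Fin 3 → ℝ) : Integrable (fun z => s8v m z ^ 2) s8sig := by
  apply s8_bdd ((s8v_cont m).pow 2) ((∑ i, |m i|) ^ 2)
  intro z
  rw [Pi.pow_apply, abs_pow]
  exact pow_le_pow_left₀ (abs_nonneg _) (s8v_bdd m z) 2

lemma s8_P3v (m : Fin 3 → ℝ) (a : ℂ) : ∫ w, s8K (a, w) * s8v m w ∂s8sig = 0 := by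
  have : ∀ w, s8K (a, w) * s8v m w = ∑ i, m i * (s8p (s8t a w) * s8n i w) := by
    intro w; unfold s8v s8K; rw [Finset.mul_sum]; congr 1; ext i; ring
  simp only [this]
  rw [integral_finsetSum _ (fun i _ => (s8_mul_n (s8_P1 a) i).const_mul _)]
  simp [integral_const_mul, s8_P3]

lemma s8_Bv {b : ℂ → ℝ} (hb : Measurable b) (hb2 : Integrable (fun z => b z ^ 2) s8sig) (m : Fin 3 → ℝ) :
    ∫ q : ℂ × ℂ, s8K q * (b q.1 * s8v m q.2) ∂(s8sig.prod s8sig) = 0 := by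
  rw [integral_prod _ (s8_D0 hb hb2 (s8v_cont m).measurable (s8v_sq m))]
  have : ∀ z, ∫ w, s8K (z, w) * (b z * s8v m w) ∂s8sig = 0 := by
    intro z
    have h : ∀ w, s8K (z, w) * (b z * s8v m w) = b z * (s8K (z, w) * s8v m w) := fun w => by ring
    simp only [h]
    rw [integral_const_mul, s8_P3v, mul_zero]
  simp [this]

lemma s8_vB {b : ℂ → ℝ} (hb : Measurable b) (hb2 : Integrable (fun z => b z ^ 2) s8sig) (m : Fin 3 → ℝ) :
    ∫ q : ℂ × ℂ, s8K q * (s8v m q.1 * b q.2) ∂(s8sig.prod s8sig) = 0 := by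
  rw [← s8_Bv hb hb2 m]
  have := integral_prod_swap (μ := s8sig) (ν := s8sig) (fun q : ℂ × ℂ => s8K q * (b q.1 * s8v m q.2))
  rw [← this]
  simp only [s8K_swap, Prod.fst_swap, Prod.snd_swap]
  congr 1; ext q; ring

lemma s8_L1 {g : ℂ → ℝ} (hg : Measurable g) (hg2 : Integrable (fun z => g z ^ 2) s8sig) : Integrable g s8sig := by
  refine Integrable.mono' (hg2.add (integrable_const 1)) hg.aestronglyMeasurable (ae_of_all _ fun z => ?_)
  simp only [Pi.add_apply, Real.norm_eq_abs]
  rw [← sq_abs]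
  nlinarith [sq_nonneg (|g z| - 1), abs_nonneg (g z)]

lemma s8_main {g : ℂ → ℝ} (hg : Measurable g) (hg2 : Integrable (fun z => g z ^ 2) s8sig)
    (h0 : ∫ z, g z ∂s8sig = 0) :
    Integrable (fun q : ℂ × ℂ => Real.log (1 - s8t q.1 q.2) * (g q.1 * g q.2)) (s8sig.prod s8sig) ∧
    -∫ q : ℂ × ℂ, Real.log (1 - s8t q.1 q.2) * (g q.1 * g q.2) ∂(s8sig.prod s8sig) ≤
      2 * Real.pi * ∫ z, g z ^ 2 ∂s8sig := by
  have hg1 := s8_L1 hg hg2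
  set m : Fin 3 → ℝ := fun i => ∫ z, g z * s8n i z ∂s8sig with hm
  set c : ℝ := 3 / (4 * Real.pi) with hc
  have hpi := Real.pi_pos
  have hvm := (s8v_cont m).measurable
  have hgn := fun i => s8_mul_n hg1 i
  -- products with v
  have hgv : Integrable (fun z => g z * s8v m z) s8sig :=
    hg1.mul_bdd (c := ∑ i, |m i|) (s8v_cont m).aestronglyMeasurable (ae_of_all _ (s8v_bdd m))
  have Igv : ∫ z, g z * s8v m z ∂s8sig = ∑ i, m i ^ 2 := by
    have : ∀ z, g z * s8v m z = ∑ i, m i * (g z * s8n i z) := by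
      intro z; unfold s8v; rw [Finset.mul_sum]; congr 1; ext i; ring
    simp only [this]
    rw [integral_finsetSum _ (fun i _ => (hgn i).const_mul _)]
    simp only [integral_const_mul]
    congr 1; ext i; rw [sq]
  have hn1 : ∀ i, Integrable (s8n i) s8sig := fun i => s8_bdd (s8n_cont i) 1 (s8n_abs i)
  have hnn : ∀ i j, Integrable (fun z => s8n i z * s8n j z) s8sig := fun i j => s8_mul_n (hn1 i) j
  have Inn : ∀ i, ∑ j, m j * ∫ z, s8n j z * s8n i z ∂s8sig = 4 * Real.pi / 3 * m i := by
    intro i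
    have h1 : ∀ a, ∑ j, s8n j a * ∫ z, s8n j z * s8n i z ∂s8sig = 4 * Real.pi / 3 * s8n i a := by
      intro a
      rw [← s8_P4 a i]
      have : ∀ y, s8t a y * s8n i y = ∑ j, s8n j a * (s8n j y * s8n i y) := by
        intro y; unfold s8t; rw [Finset.sum_mul]; congr 1; ext j; ring
      simp only [this]
      rw [integral_finsetSum _ (fun j _ => (hnn j i).const_mul _)]
      simp only [integral_const_mul]
    have h2 : ∫ a, ∑ j, (g a * s8n j a) * (∫ z, s8n j z * s8n i z ∂s8sig) ∂s8sig = 4 * Real.pi / 3 * m i := by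
      rw [hm, ← integral_const_mul]
      congr 1; ext a
      have := h1 a
      simp only [mul_assoc]
      rw [← Finset.mul_sum, this]; ring
    rw [integral_finsetSum _ (fun j _ => (hgn j).mul_const _)] at h2
    simp only [integral_mul_const] at h2
    exact h2
  have Ivv : ∫ z, s8v m z ^ 2 ∂s8sig = 4 * Real.pi / 3 * ∑ i, m i ^ 2 := by
    have : ∀ z, s8v m z ^ 2 = ∑ i, m i * ∑ j, m j * (s8n j z * s8n i z) := by
      intro z; rw [sq]; unfold s8v; rw [Finset.sum_mul]
      congr 1; ext i; rw [Finset.mul_sum, Finset.mul_sum]; congr 1; ext j; ring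
    simp only [this]
    rw [integral_finsetSum _ (fun i _ => (integrable_finsetSum _ (fun j _ => (hnn j i).const_mul _)).const_mul _)]
    rw [Finset.mul_sum]
    congr 1; ext i
    rw [integral_const_mul, integral_finsetSum _ (fun j _ => (hnn j i).const_mul _)]
    simp only [integral_const_mul]
    rw [Inn i]; ring
  set u : ℂ → ℝ := fun z => g z - c * s8v m z with hu
  have hum : Measurable u := by fun_prop
  have husq : ∀ z, u z ^ 2 = 1 * g z ^ 2 + (-(2 * c)) * (g z * s8v m z) + c ^ 2 * s8v m z ^ 2 := by
    intro z; simp only [hu]; ring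
  have hu2 : Integrable (fun z => u z ^ 2) s8sig := by
    simp only [husq]
    exact (s8_int3 hg2 hgv (s8v_sq m) _ _ _).1
  have Iuu : ∫ z, u z ^ 2 ∂s8sig = ∫ z, g z ^ 2 ∂s8sig - 2 * c * (∑ i, m i ^ 2) + c ^ 2 * (4 * Real.pi / 3 * ∑ i, m i ^ 2) := by
    simp only [husq]
    rw [(s8_int3 hg2 hgv (s8v_sq m) _ _ _).2, Igv, Ivv]
    ring
  have hB := s8_schur hum hu2
  have hBgg := s8_D0 hg hg2 hg hg2
  have hBgv := s8_D0 hg hg2 hvm (s8v_sq m)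
  have hBvu := s8_D0 hvm (s8v_sq m) hum hu2
  have eB : ∫ q : ℂ × ℂ, s8K q * (u q.1 * u q.2) ∂(s8sig.prod s8sig) =
      ∫ q : ℂ × ℂ, s8K q * (g q.1 * g q.2) ∂(s8sig.prod s8sig) := by
    have : ∀ q : ℂ × ℂ, s8K q * (u q.1 * u q.2) = 1 * (s8K q * (g q.1 * g q.2))
       + (-c) * (s8K q * (g q.1 * s8v m q.2)) + (-c) * (s8K q * (s8v m q.1 * u q.2)) := by
      intro q; simp only [hu]; ring
    simp only [this]
    rw [(s8_int3 hBgg hBgv hBvu _ _ _).2, s8_Bv hg hg2, s8_vB hum hu2]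
    ring
  -- relation with log
  have hgg : Integrable (fun q : ℂ × ℂ => g q.1 * g q.2) (s8sig.prod s8sig) := hg1.mul_prod hg1
  have hti : ∀ i, Integrable (fun q : ℂ × ℂ => (g q.1 * s8n i q.1) * (g q.2 * s8n i q.2)) (s8sig.prod s8sig) :=
    fun i => (hgn i).mul_prod (hgn i)
  have et : ∀ q : ℂ × ℂ, s8t q.1 q.2 * (g q.1 * g q.2) = ∑ i, (g q.1 * s8n i q.1) * (g q.2 * s8n i q.2) := by
    intro q; unfold s8t; rw [Finset.sum_mul]; congr 1; ext i; ring
  have hIt : Integrable (fun q : ℂ × ℂ => s8t q.1 q.2 * (g q.1 * g q.2)) (s8sig.prod s8sig) := by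
    simp only [et]
    exact integrable_finsetSum _ (fun i _ => hti i)
  have Itt : ∫ q : ℂ × ℂ, s8t q.1 q.2 * (g q.1 * g q.2) ∂(s8sig.prod s8sig) = ∑ i, m i ^ 2 := by
    simp only [et]
    rw [integral_finsetSum _ (fun i _ => hti i)]
    congr 1; ext i
    rw [integral_prod_mul (fun z => g z * s8n i z) (fun z => g z * s8n i z), sq]
  have Igg : ∫ q : ℂ × ℂ, g q.1 * g q.2 ∂(s8sig.prod s8sig) = 0 := by
    rw [integral_prod_mul g g, h0, zero_mul]
  have eL : ∀ q : ℂ × ℂ, Real.log (1 - s8t q.1 q.2) * (g q.1 * g q.2) =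
      19 / 100 * (g q.1 * g q.2) + (-(3 / 2)) * (s8t q.1 q.2 * (g q.1 * g q.2)) + (-1) * (s8K q * (g q.1 * g q.2)) := by
    intro q; unfold s8K s8p; ring
  simp only [eL]
  refine ⟨(s8_int3 hgg hIt hBgg _ _ _).1, ?_⟩
  rw [(s8_int3 hgg hIt hBgg _ _ _).2, Itt, Igg]
  rw [eB, Iuu] at hB
  have hcc : 2 * Real.pi * (-(2 * c * (∑ i, m i ^ 2)) + c ^ 2 * (4 * Real.pi / 3 * ∑ i, m i ^ 2)) = - (3 / 2) * ∑ i, m i ^ 2 := by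
    rw [hc]; field_simp; ring
  linarith

lemma s8_sig_integral (h : ℂ → ℝ) : ∫ z, h z ∂s8sig = ∫ z, s8J z * h z := by
  unfold s8sig
  rw [integral_withDensity_eq_integral_toReal_smul (by have := s8J_cont.measurable; fun_prop) (ae_of_all _ (by simp))]
  simp [ENNReal.toReal_ofReal (s8J_pos _).le]

lemma s8_sig_integrable (h : ℂ → ℝ) : Integrable h s8sig ↔ Integrable (fun z => s8J z * h z) := by
  unfold s8sig
  rw [integrable_withDensity_iff_integrable_smul' (by have := s8J_cont.measurable; fun_prop) (ae_of_all _ (by simp))]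
  simp [ENNReal.toReal_ofReal (s8J_pos _).le]

lemma s8_logN : Integrable (fun z : ℂ => Real.log (1 + Complex.normSq z) ^ 2) s8sig := by
  rw [s8_sig_integrable]
  have h := (integrable_rpow_neg_one_add_norm_sq (E := ℂ) (μ := volume) (r := 3) (by simp; norm_num)).const_mul 64
  refine h.mono' ?_ (ae_of_all _ fun z => ?_)
  · have := s8J_cont.measurable
    have := s8_cN.measurable
    exact Measurable.aestronglyMeasurable (by fun_prop)
  · rw [← Complex.normSq_eq_norm_sq]
    have hp := s8_pos z
    have hge : 1 ≤ 1 + Complex.normSq z := by have := Complex.normSq_nonneg z; linarith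
    unfold s8J
    generalize 1 + Complex.normSq z = a at *
    have hl := Real.log_le_rpow_div hp.le (show (0:ℝ) < 1 / 4 by norm_num)
    have hl0 := Real.log_nonneg hge
    have h2 : Real.log a ^ 2 ≤ 16 * a ^ (1 / 2 : ℝ) := by
      calc Real.log a ^ 2 ≤ (a ^ (1 / 4 : ℝ) / (1 / 4)) ^ 2 := pow_le_pow_left₀ hl0 hl 2
        _ = 16 * (a ^ (1 / 4 : ℝ)) ^ (2 : ℕ) := by ring
        _ = _ := by rw [← Real.rpow_natCast, ← Real.rpow_mul hp.le]; norm_num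
    have h3 : a ^ (-3 / 2 : ℝ) = a ^ (1 / 2 : ℝ) / a ^ 2 := by
      rw [← Real.rpow_natCast a 2, ← Real.rpow_sub hp]; norm_num
    rw [h3, Real.norm_eq_abs, abs_of_nonneg (by positivity)]
    calc 4 / a ^ 2 * Real.log a ^ 2 ≤ 4 / a ^ 2 * (16 * a ^ (1 / 2 : ℝ)) :=
          mul_le_mul_of_nonneg_left h2 (by positivity)
      _ = _ := by ring

lemma s8_logid (x y : ℂ) (h : y ≠ x) : Real.log ‖x - y‖ = 1 / 2 * Real.log (1 - s8t x y)
    + 1 / 2 * (Real.log (1 + Complex.normSq x) - Real.log 2) + 1 / 2 * Real.log (1 + Complex.normSq y) := by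
  have hx := (s8_pos x).ne'
  have hy := (s8_pos y).ne'
  have hn : ‖x - y‖ ≠ 0 := by rw [norm_ne_zero_iff, sub_ne_zero]; exact h.symm
  rw [s8_one_sub, Complex.normSq_eq_norm_sq (x - y), Real.log_div (by positivity) (by positivity),
    Real.log_mul (by norm_num) (by positivity), Real.log_mul hx hy, Real.log_pow]
  push_cast; ring

lemma s8_complex (F : ℂ → ℝ) (hF : Measurable F) (h1 : Integrable (fun z => F z ^ 2 / (2 * s8J z)))
    (h0 : ∫ z, F z = 0) :
    0 ≤ ∫ x, F x * (F x / (2 * s8J x) - -(1 / (2 * Real.pi)) * ∫ y, Real.log ‖x - y‖ * F y) := by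
  have hJ := s8J_cont.measurable
  have hJp := fun z => (s8J_pos z).ne'
  have hpi := Real.pi_pos
  set g : ℂ → ℝ := fun z => F z / s8J z with hgdef
  have hg : Measurable g := by fun_prop
  have hg2 : Integrable (fun z => g z ^ 2) s8sig := by
    rw [s8_sig_integrable]
    have : (fun z => s8J z * g z ^ 2) = fun z => 2 * (F z ^ 2 / (2 * s8J z)) := by
      ext z; simp only [hgdef]; have := hJp z; field_simp
    rw [this]
    exact h1.const_mul 2
  have hFg : ∀ z, s8J z * g z = F z := by
    intro z; simp only [hgdef]; have := hJp z; field_simp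
  have hg0 : ∫ z, g z ∂s8sig = 0 := by
    rw [s8_sig_integral]; simp only [hFg]; exact h0
  have hg1 := s8_L1 hg hg2
  obtain ⟨hLi, hL⟩ := s8_main hg hg2 hg0
  have hlogN := s8_logN
  have hcN := s8_cN.measurable
  have hlg : Integrable (fun y => Real.log (1 + Complex.normSq y) * g y) s8sig := by
    refine (hg2.add hlogN).mono' (Measurable.aestronglyMeasurable (by fun_prop)) (ae_of_all _ fun y => ?_)
    simp only [Pi.add_apply, Real.norm_eq_abs, abs_mul]
    rw [← sq_abs (g y), ← sq_abs (Real.log _)]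
    nlinarith [sq_nonneg (|g y| - |Real.log (1 + Complex.normSq y)|), sq_nonneg (|g y|), sq_nonneg (|Real.log (1 + Complex.normSq y)|)]
  set A : ℝ := ∫ y, Real.log (1 + Complex.normSq y) * g y ∂s8sig with hA
  have hone : Integrable (fun _ : ℂ => (1:ℝ) ^ 2) s8sig := integrable_const _
  have hae := (s8_D0 (u := fun _ => 1) measurable_const hone hg hg2).prod_right_ae
  have hPsi : ∀ᵐ x ∂s8sig, ∫ y, Real.log ‖x - y‖ * F y =
      1 / 2 * (∫ y, Real.log (1 - s8t x y) * g y ∂s8sig) + 1 / 2 * A := by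
    filter_upwards [hae] with x hx
    have hK : Integrable (fun y => s8K (x, y) * g y) s8sig := by simpa using hx
    have htg : Integrable (fun y => s8t x y * g y) s8sig := by
      have : ∀ y, s8t x y * g y = ∑ i, s8n i x * (g y * s8n i y) := by
        intro y; unfold s8t; rw [Finset.sum_mul]; congr 1; ext i; ring
      simp only [this]
      exact integrable_finsetSum _ (fun i _ => (s8_mul_n hg1 i).const_mul _)
    have hlt : Integrable (fun y => Real.log (1 - s8t x y) * g y) s8sig := by
      have : ∀ y, Real.log (1 - s8t x y) * g y = 19 / 100 * g y + (-(3 / 2)) * (s8t x y * g y) + (-1) * (s8K (x, y) * g y) := by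
        intro y; unfold s8K s8p; ring
      simp only [this]
      exact (s8_int3 hg1 htg hK _ _ _).1
    have e1 : ∫ y, Real.log ‖x - y‖ * F y = ∫ y, Real.log ‖x - y‖ * g y ∂s8sig := by
      rw [s8_sig_integral]
      congr 1; ext y; rw [← hFg y]; ring
    have hne : ∀ᵐ y ∂s8sig, y ≠ x := s8sig_ac.ae_le (show ∀ᵐ y ∂(volume : Measure ℂ), y ≠ x from by
      simp [ae_iff])
    have e2 : ∫ y, Real.log ‖x - y‖ * g y ∂s8sig = ∫ y, (1 / 2 * (Real.log (1 - s8t x y) * g y)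
        + (1 / 2 * (Real.log (1 + Complex.normSq x) - Real.log 2)) * g y
        + 1 / 2 * (Real.log (1 + Complex.normSq y) * g y)) ∂s8sig := by
      apply integral_congr_ae
      filter_upwards [hne] with y hy
      rw [s8_logid x y hy]; ring
    rw [e1, e2, (s8_int3 hlt hg1 hlg _ _ _).2, hg0]
    ring
  have hI : Integrable (fun x => g x * ∫ y, Real.log (1 - s8t x y) * g y ∂s8sig) s8sig := by
    have := hLi.integral_prod_left
    refine this.congr (ae_of_all _ fun x => ?_)
    simp only
    rw [← integral_const_mul]
    congr 1; ext y; ring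
  have eI : ∫ x, g x * ∫ y, Real.log (1 - s8t x y) * g y ∂s8sig ∂s8sig =
      ∫ q : ℂ × ℂ, Real.log (1 - s8t q.1 q.2) * (g q.1 * g q.2) ∂(s8sig.prod s8sig) := by
    rw [integral_prod _ hLi]
    congr 1; ext x
    rw [← integral_const_mul]
    congr 1; ext y; ring
  have e3 : ∫ x, F x * (F x / (2 * s8J x) - -(1 / (2 * Real.pi)) * ∫ y, Real.log ‖x - y‖ * F y) =
      ∫ x, (1 / 2 * g x ^ 2 + 1 / (4 * Real.pi) * (g x * ∫ y, Real.log (1 - s8t x y) * g y ∂s8sig)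
        + A / (4 * Real.pi) * g x) ∂s8sig := by
    have : ∫ x, F x * (F x / (2 * s8J x) - -(1 / (2 * Real.pi)) * ∫ y, Real.log ‖x - y‖ * F y) =
      ∫ x, g x * (g x / 2 - -(1 / (2 * Real.pi)) * ∫ y, Real.log ‖x - y‖ * F y) ∂s8sig := by
      rw [s8_sig_integral]
      congr 1; ext x
      rw [← mul_assoc, hFg]
      congr 2
      simp only [hgdef]; have := hJp x; field_simp
    rw [this]
    apply integral_congr_ae
    filter_upwards [hPsi] with x hx
    rw [hx]
    field_simp
    ring
  rw [e3, (s8_int3 hg2 hI hg1 _ _ _).2, eI, hg0]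
  generalize (∫ q : ℂ × ℂ, Real.log (1 - s8t q.1 q.2) * (g q.1 * g q.2) ∂(s8sig.prod s8sig)) = B at *
  have : 0 ≤ 1 / (4 * Real.pi) * (2 * Real.pi * (∫ z, g z ^ 2 ∂s8sig) + B) :=
    mul_nonneg (by positivity) (by linarith)
  have e : 1 / (4 * Real.pi) * (2 * Real.pi * (∫ z, g z ^ 2 ∂s8sig) + B) = 1 / 2 * (∫ z, g z ^ 2 ∂s8sig) + 1 / (4 * Real.pi) * B := by
    field_simp; ring
  linarith

lemma s8_int_add {X : Type*} [MeasurableSpace X] {μ : Measure X} {A B : X → ℝ} (hA : Integrable A μ)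
    (h0 : ∫ x, A x ∂μ = 0) : ∫ x, (A x + B x) ∂μ = ∫ x, B x ∂μ := by
  by_cases hB : Integrable B μ
  · rw [integral_add hA hB, h0, zero_add]
  · rw [integral_undef hB, integral_undef]
    intro h
    exact hB ((integrable_add_iff_integrable_right hA).mp h)

/-- the isometry followed by scaling -/
def s8e : ℂ ≃ₗᵢ[ℝ] E2 := Complex.orthonormalBasisOneI.repr

lemma s8_chg (ν : ℝ) (hν : 0 < ν) (h : E2 → ℝ) : ∫ x, h x = ν ^ 2 * ∫ z : ℂ, h (ν • s8e z) := by
  have e1 := s8e.measurePreserving.integral_comp s8e.toHomeomorph.measurableEmbedding (fun y => h (ν • y))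
  rw [e1, Measure.integral_comp_smul]
  simp
  rw [← mul_assoc, mul_inv_cancel₀ (by positivity), one_mul]

lemma s8_chgI (ν : ℝ) (hν : 0 < ν) (h : E2 → ℝ) : Integrable h ↔ Integrable (fun z : ℂ => h (ν • s8e z)) := by
  have e1 := s8e.measurePreserving.integrable_comp_emb s8e.toHomeomorph.measurableEmbedding (g := fun y => h (ν • y))
  rw [← integrable_comp_smul_iff volume h hν.ne', ← e1]
  rfl

lemma s8_Unu (ν : ℝ) (hν : 0 < ν) (z : ℂ) : Unu ν (ν • s8e z) = 2 * s8J z / ν ^ 2 := by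
  unfold Unu U2 s8J
  rw [smul_smul, one_div_mul_cancel hν.ne', one_smul, s8e.norm_map, ← Complex.normSq_eq_norm_sq]
  ring

/-- positivity of the quadratic form on mean-zero functions. -/
theorem stmt8 (ν : ℝ) (hν : 0 < ν) (f : E2 → ℝ) (hf : Differentiable ℝ f)
    (h1 : Integrable (fun y : E2 => (f y) ^ 2 / Unu ν y))
    (h2 : Integrable (fun y : E2 => ‖gradient f y‖ ^ 2 / Unu ν y))
    (h0 : (∫ y : E2, f y) = 0) :
    0 ≤ ∫ y : E2, f y * (f y / Unu ν y - Psi f y) := by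
  have hν2 : ν ^ 2 ≠ 0 := by positivity
  set F : ℂ → ℝ := fun z => f (ν • s8e z) with hF
  have hFc : Continuous F := by
    have := hf.continuous
    have := s8e.continuous
    fun_prop
  have h1' : Integrable (fun z => F z ^ 2 / (2 * s8J z)) := by
    rw [s8_chgI ν hν] at h1
    refine (h1.const_mul (ν ^ 2)⁻¹).congr (ae_of_all _ fun z => ?_)
    simp only [s8_Unu ν hν]
    have := (s8J_pos z).ne'
    simp only [hF]
    field_simp
  have h0' : ∫ z, F z = 0 := by
    rw [s8_chg ν hν] at h0
    exact (mul_eq_zero.mp h0).resolve_left hν2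
  have hFi : Integrable F := by
    by_contra hni
    have hJ := s8J_cont.measurable
    have hFm := hFc.measurable
    have hg2 : Integrable (fun z => (F z / s8J z) ^ 2) s8sig := by
      rw [s8_sig_integrable]
      refine (h1'.const_mul 2).congr (ae_of_all _ fun z => ?_)
      have := (s8J_pos z).ne'
      field_simp
    have := s8_L1 (by fun_prop) hg2
    rw [s8_sig_integrable] at this
    apply hni
    refine this.congr (ae_of_all _ fun z => ?_)
    have := (s8J_pos z).ne'
    field_simp
  have hPsi : ∀ z, Psi f (ν • s8e z) = ν ^ 2 * (-(1 / (2 * Real.pi)) * ∫ y, Real.log ‖z - y‖ * F y) := by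
    intro z
    unfold Psi
    rw [s8_chg ν hν]
    have e : ∫ y : ℂ, Real.log ‖ν • s8e z - ν • s8e y‖ * f (ν • s8e y) = ∫ y, (Real.log ν * F y + Real.log ‖z - y‖ * F y) := by
      apply integral_congr_ae
      have hne : ∀ᵐ y ∂(volume : Measure ℂ), y ≠ z := by simp [ae_iff]
      filter_upwards [hne] with y hy
      rw [← smul_sub, ← map_sub, norm_smul, s8e.norm_map, Real.norm_of_nonneg hν.le,
        Real.log_mul hν.ne' (norm_ne_zero_iff.mpr (sub_ne_zero.mpr hy.symm))]
      ring
    rw [e, s8_int_add (hFi.const_mul _) (by rw [integral_const_mul, h0', mul_zero])]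
    ring
  have key := s8_complex F hFc.measurable h1' h0'
  rw [s8_chg ν hν]
  refine mul_nonneg (by positivity) ?_
  have e : (fun z : ℂ => f (ν • s8e z) * (f (ν • s8e z) / Unu ν (ν • s8e z) - Psi f (ν • s8e z))) =
      fun x => ν ^ 2 * (F x * (F x / (2 * s8J x) - -(1 / (2 * Real.pi)) * ∫ y, Real.log ‖x - y‖ * F y)) := by
    ext z
    rw [hPsi, s8_Unu ν hν]
    have := (s8J_pos z).ne'
    simp only [hF]
    field_simp
  rw [e, integral_const_mul]
  exact mul_nonneg (by positivity) key
end
end
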